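/- arXiv:1203.2009 — 2 statements merged into one kernel-verified Lean document; each statement's English description precedes it below -/
import Mathlib

section
/- The Hamiltonians H_1, …, H_N are mutually commutative: H_i H_j = H_j H_i in R for all 1 ≤ i, j ≤ N. -/
set_option linter.all false

section FST
variable {R : Type*} [Ring R] [Algebra ℂ R] {ι : Type*} [Fintype ι] [LinearOrder ι]

/-- skew trigonometric coefficient -/
noncomputable def sco (a b : ℂ) (m n : ι) : ℂ :=
  b / (a - b) + (if m < n then 1 else 0) + (if m = n then 1 / 2 else 0)

lemma sco_skew (a b : ℂ) (h : a ≠ b) (m n : ι) : sco b a n m = - sco a b m n := by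
  have h1 : a - b ≠ 0 := sub_ne_zero.2 h
  have h2 : b - a ≠ 0 := sub_ne_zero.2 h.symm
  unfold sco
  rcases lt_trichotomy m n with hh | hh | hh
  · simp only [hh, hh.not_gt, hh.ne, hh.ne', if_true, if_false]
    field_simp
    ring
  · subst hh
    simp only [lt_irrefl, if_true, if_false]
    field_simp
    ring
  · simp only [hh, hh.not_gt, hh.ne, hh.ne', if_true, if_false]
    field_simp
    ring

lemma sco_P (a b c : ℂ) (hab : a ≠ b) (hac : a ≠ c) (hbc : b ≠ c) (m l n : ι) :
    sco a b m n * sco a c n l - sco a b m l * sco b c n l + sco a c m l * sco b c n m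
      = if m = l ∧ m = n then 1 / 4 else 0 := by
  have h1 : a - b ≠ 0 := sub_ne_zero.2 hab
  have h2 : a - c ≠ 0 := sub_ne_zero.2 hac
  have h3 : b - c ≠ 0 := sub_ne_zero.2 hbc
  unfold sco
  rcases lt_trichotomy m n with hh | hh | hh <;> rcases lt_trichotomy m l with h' | h' | h' <;>
  rcases lt_trichotomy n l with hk | hk | hk <;> first
    | (exfalso; order)
    | (subst_vars
       simp only [*, hh.not_gt, hh.ne, hh.ne', h'.not_gt, h'.ne, h'.ne', hk.not_gt, hk.ne, hk.ne',
         if_true, if_false, and_true, true_and, and_false, false_and, lt_irrefl, and_self]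
       field_simp
       ring)
    | (subst_vars
       simp only [*, hh.not_gt, hh.ne, hh.ne', 
         if_true, if_false, and_true, true_and, and_false, false_and, lt_irrefl, and_self]
       field_simp
       ring)
    | (subst_vars
       simp only [*, h'.not_gt, h'.ne, h'.ne', 
         if_true, if_false, and_true, true_and, and_false, false_and, lt_irrefl, and_self]
       field_simp
       ring)
    | (subst_vars
       simp only [if_true, lt_irrefl, and_self, if_false]
       field_simp
       ring)

lemma sco_Q (a b c : ℂ) (hab : a ≠ b) (hac : a ≠ c) (hbc : b ≠ c) (k n m : ι) :
    - (sco a b m n * sco a c k m) + sco a b k n * sco b c k m - sco a c k n * sco b c n m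
      = - if k = n ∧ k = m then 1 / 4 else 0 := by
  have h1 : a - b ≠ 0 := sub_ne_zero.2 hab
  have h2 : a - c ≠ 0 := sub_ne_zero.2 hac
  have h3 : b - c ≠ 0 := sub_ne_zero.2 hbc
  unfold sco
  rcases lt_trichotomy m n with hh | hh | hh <;> rcases lt_trichotomy m k with h' | h' | h' <;>
  rcases lt_trichotomy n k with hk | hk | hk <;> first
    | (exfalso; order)
    | (subst_vars
       simp only [*, hh.not_gt, hh.ne, hh.ne', h'.not_gt, h'.ne, h'.ne', hk.not_gt, hk.ne, hk.ne',
         if_true, if_false, and_true, true_and, and_false, false_and, lt_irrefl, and_self]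
       field_simp
       ring)
    | (subst_vars
       simp only [*, hh.not_gt, hh.ne, hh.ne', 
         if_true, if_false, and_true, true_and, and_false, false_and, lt_irrefl, and_self]
       field_simp
       ring)
    | (subst_vars
       simp only [*, h'.not_gt, h'.ne, h'.ne', 
         if_true, if_false, and_true, true_and, and_false, false_and, lt_irrefl, and_self]
       field_simp
       ring)
    | (subst_vars
       simp only [if_true, lt_irrefl, and_self, if_false]
       field_simp
       ring)

lemma bsl {α : Type*} (s : Finset α) (f : α → R) (y : R) : ⁅∑ i ∈ s, f i, y⁆ = ∑ i ∈ s, ⁅f i, y⁆ := by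
  simp only [Ring.lie_def, Finset.sum_mul, Finset.mul_sum, Finset.sum_sub_distrib]

lemma bsr {α : Type*} (s : Finset α) (f : α → R) (y : R) : ⁅y, ∑ i ∈ s, f i⁆ = ∑ i ∈ s, ⁅y, f i⁆ := by
  simp only [Ring.lie_def, Finset.sum_mul, Finset.mul_sum, Finset.sum_sub_distrib]

lemma bml (c : ℂ) (x y : R) : ⁅c • x, y⁆ = c • ⁅x, y⁆ := by
  simp only [Ring.lie_def, smul_mul_assoc, mul_smul_comm, smul_sub]

lemma bmr (c : ℂ) (x y : R) : ⁅x, c • y⁆ = c • ⁅x, y⁆ := by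
  simp only [Ring.lie_def, smul_mul_assoc, mul_smul_comm, smul_sub]

lemma br_sum (x y : ι → ι → ℂ) (X Y : ι → ι → R) :
    ⁅∑ m, ∑ n, x m n • X m n, ∑ k, ∑ l, y k l • Y k l⁆ =
      ∑ m, ∑ n, ∑ k, ∑ l, (x m n * y k l) • ⁅X m n, Y k l⁆ := by
  simp only [bsl, bml, Finset.smul_sum]
  simp only [bsr, bmr, smul_smul, Finset.smul_sum]

lemma cybe (a b c : ℂ) (hab : a ≠ b) (hac : a ≠ c) (hbc : b ≠ c)
    (X Y Z : ι → ι → R) (P Q : ι → ι → ι → R) (hPQ : ∀ m, P m m m = Q m m m)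
    (hXY : ∀ m n k l, ⁅X m n, Y k l⁆ = (if n = k then P m l n else 0) - (if l = m then Q k n m else 0))
    (hXZ : ∀ m n k l, ⁅X m n, Z k l⁆ = (if m = k then Q m n l else 0) - (if l = n then P m n k else 0))
    (hYZ : ∀ m n k l, ⁅Y m n, Z k l⁆ = (if m = l then P m n k else 0) - (if n = k then Q m n l else 0)) :
    ⁅∑ m, ∑ n, sco a b m n • X m n, ∑ m, ∑ n, sco a c m n • Y m n⁆
    + ⁅∑ m, ∑ n, sco a b m n • X m n, ∑ m, ∑ n, sco b c m n • Z m n⁆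
    + ⁅∑ m, ∑ n, sco a c m n • Y m n, ∑ m, ∑ n, sco b c m n • Z m n⁆ = 0 := by
  have e1 : ⁅∑ m, ∑ n, sco a b m n • X m n, ∑ m, ∑ n, sco a c m n • Y m n⁆ =
      (∑ m, ∑ l, ∑ n, (sco a b m n * sco a c n l) • P m l n)
      - ∑ k, ∑ n, ∑ m, (sco a b m n * sco a c k m) • Q k n m := by
    rw [br_sum]
    simp only [hXY, smul_sub, Finset.sum_sub_distrib, smul_ite, smul_zero, Finset.sum_ite_eq,
      Finset.sum_ite_eq', Finset.mem_univ, if_true]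
    congr 1
    · refine Finset.sum_congr rfl fun m _ => ?_
      rw [Finset.sum_comm_cycle]
      refine Finset.sum_congr rfl fun l _ => ?_
      simp
    · rw [Finset.sum_comm]
      rw [Finset.sum_comm_cycle]
  have e2 : ⁅∑ m, ∑ n, sco a b m n • X m n, ∑ m, ∑ n, sco b c m n • Z m n⁆ =
      (∑ k, ∑ n, ∑ m, (sco a b k n * sco b c k m) • Q k n m)
      - ∑ m, ∑ l, ∑ n, (sco a b m l * sco b c n l) • P m l n := by
    rw [br_sum]
    simp only [hXZ, smul_sub, Finset.sum_sub_distrib, smul_ite, smul_zero, Finset.sum_ite_eq,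
      Finset.sum_ite_eq', Finset.mem_univ, if_true]
    congr 1
    refine Finset.sum_congr rfl fun k _ => ?_
    refine Finset.sum_congr rfl fun n _ => ?_
    rw [Finset.sum_comm]
    simp
  have e3 : ⁅∑ m, ∑ n, sco a c m n • Y m n, ∑ m, ∑ n, sco b c m n • Z m n⁆ =
      (∑ m, ∑ l, ∑ n, (sco a c m l * sco b c n m) • P m l n)
      - ∑ k, ∑ n, ∑ m, (sco a c k n * sco b c n m) • Q k n m := by
    rw [br_sum]
    simp only [hYZ, smul_sub, Finset.sum_sub_distrib, smul_ite, smul_zero, Finset.sum_ite_eq,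
      Finset.sum_ite_eq', Finset.mem_univ, if_true]
    congr 1
    refine Finset.sum_congr rfl fun k _ => ?_
    refine Finset.sum_congr rfl fun n _ => ?_
    rw [Finset.sum_comm]
    simp
  have eP : (∑ m, ∑ l, ∑ n, (sco a b m n * sco a c n l - sco a b m l * sco b c n l
      + sco a c m l * sco b c n m) • P m l n) = ∑ m, (1 / 4 : ℂ) • P m m m := by
    simp only [sco_P a b c hab hac hbc, ite_smul, zero_smul, ite_and]
    simp
  have eQ : (∑ k, ∑ n, ∑ m, (- (sco a b m n * sco a c k m) + sco a b k n * sco b c k m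
      - sco a c k n * sco b c n m) • Q k n m) = - ∑ m, (1 / 4 : ℂ) • Q m m m := by
    simp only [sco_Q a b c hab hac hbc, neg_smul, ite_smul, zero_smul, ite_and]
    simp
  rw [e1, e2, e3]
  have : (∑ m, (1 / 4 : ℂ) • P m m m) + - ∑ m, (1 / 4 : ℂ) • Q m m m = 0 := by simp [hPQ]
  rw [← eP, ← eQ] at this
  simp only [add_smul, sub_smul, neg_smul, Finset.sum_add_distrib, Finset.sum_sub_distrib,
    Finset.sum_neg_distrib] at this
  rw [← this]
  abel

/-- dressing coefficient -/
def phi {S : Type*} [Ring S] (o : ι) (h : S) (t : ι → S) (n m : ι) : S :=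
  (if m = o then -1 else t m - h) * (if n = o then t o + (if m = o then 0 else h) else -1)

def shf {S : Type*} [Ring S] (h : S) (t : ι → S) (m n c : ι) : S :=
  t c - (if c = m then h else 0) + (if c = n then h else 0)

lemma phi_id {S : Type*} [CommRing S] (o : ι) (h : S) (t : ι → S) (m n k l : ι) :
    phi o h t n m * phi o h (shf h t m n) l k - phi o h t l k * phi o h (shf h t k l) n m
    = (if m = l then h * phi o h t n k else 0) - (if n = k then h * phi o h t l m else 0) := by
  unfold phi shf
  by_cases h1 : m = o <;> by_cases h2 : n = o <;> by_cases h3 : k = o <;> by_cases h4 : l = o <;>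
  grind

lemma phi_idR (o : ι) (h : R) (t : ι → R) (hh : ∀ r, h * r = r * h) (ht : ∀ m n, t m * t n = t n * t m)
    (m n k l : ι) :
    phi o h t n m * phi o h (shf h t m n) l k - phi o h t l k * phi o h (shf h t k l) n m
    = (if m = l then h * phi o h t n k else 0) - (if n = k then h * phi o h t l m else 0) := by
  let s : Set R := insert h (Set.range t)
  have hs : ∀ x ∈ s, ∀ y ∈ s, x * y = y * x := by
    rintro x (rfl | ⟨a, rfl⟩) y (rfl | ⟨b, rfl⟩)
    · rfl
    · exact hh _
    · exact (hh _).symm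
    · exact ht _ _
  letI := Subring.closureCommRingOfComm hs
  let h' : Subring.closure s := ⟨h, Subring.subset_closure (Set.mem_insert _ _)⟩
  let t' : ι → Subring.closure s := fun m =>
    ⟨t m, Subring.subset_closure (Set.mem_insert_of_mem _ ⟨m, rfl⟩)⟩
  have key := congrArg (Subring.closure s).subtype (phi_id o h' t' m n k l)
  have e1 : ∀ (u : ι → Subring.closure s) n m, (Subring.closure s).subtype (phi o h' u n m) =
     phi o h (fun i => ((u i : Subring.closure s) : R)) n m := by
    intro u n m
    unfold phi
    split_ifs <;> simp [h']
  have e2 : ∀ m n, (fun c => ((shf h' t' m n c : Subring.closure s) : R)) = shf h t m n := by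
    intro m n
    funext c
    unfold shf
    split_ifs <;> simp [h', t']
  rw [map_sub, map_sub, map_mul, map_mul, apply_ite (Subring.closure s).subtype,
    apply_ite (Subring.closure s).subtype, map_mul, map_mul, e1, e1, e1, e1, e1, e1, e2, e2] at key
  simpa [h', t'] using key

structure GLSys (s : Finset ℕ) (h : R) (κ : ι → R) (E : ℕ → ι → ι → R) : Prop where
  hc : ∀ r, h * r = r * h
  kc : ∀ m r, κ m * r = r * κ m
  gl : ∀ i ∈ s, ∀ m n k l, E i m n * E i k l - E i k l * E i m n =
    (if n = k then h * E i m l else 0) - (if l = m then h * E i k n else 0)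
  cm : ∀ i ∈ s, ∀ j ∈ s, i ≠ j → ∀ m n k l, E i m n * E j k l = E j k l * E i m n

def TT (s : Finset ℕ) (κ : ι → R) (E : ℕ → ι → ι → R) (c : ι) : R := κ c + ∑ i ∈ s, E i c c

namespace GLSys
variable {s : Finset ℕ} {h : R} {κ : ι → R} {E : ℕ → ι → ι → R}

lemma E_D (S : GLSys s h κ E) {i : ℕ} (hi : i ∈ s) (m n c : ι) :
    E i m n * E i c c = E i c c * E i m n + (-(if c = m then h else 0) + (if c = n then h else 0)) * E i m n := by
  have := S.gl i hi m n c c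
  rw [sub_eq_iff_eq_add] at this
  rw [this]
  by_cases h1 : c = m <;> by_cases h2 : c = n
  · subst h1; subst h2; simp
  · subst h1; simp [h2, Ne.symm h2]; abel
  · subst h2; simp [h1]; abel
  · simp [h1, h2, Ne.symm h2]

lemma E_T (S : GLSys s h κ E) {i : ℕ} (hi : i ∈ s) (m n c : ι) :
    E i m n * TT s κ E c = shf h (TT s κ E) m n c * E i m n := by
  unfold shf TT
  rw [← Finset.add_sum_erase s _ hi]
  have h1 : E i m n * ∑ k ∈ s.erase i, E k c c = (∑ k ∈ s.erase i, E k c c) * E i m n := by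
    rw [Finset.mul_sum, Finset.sum_mul]
    refine Finset.sum_congr rfl fun k hk => ?_
    rw [Finset.mem_erase] at hk
    exact S.cm i hi k hk.2 (Ne.symm hk.1) _ _ _ _
  rw [mul_add, mul_add, h1, S.E_D hi, ← S.kc]
  noncomm_ring

lemma D_T (S : GLSys s h κ E) {i : ℕ} (hi : i ∈ s) (a c : ι) :
    Commute (E i a a) (TT s κ E c) := by
  have := S.E_T hi a a c
  unfold Commute SemiconjBy
  rw [this]
  unfold shf
  simp

lemma T_T (S : GLSys s h κ E) (a c : ι) :
    Commute (TT s κ E a) (TT s κ E c) := by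
  have h1 : Commute (κ a) (TT s κ E c) := S.kc a _
  have h2 : Commute (∑ i ∈ s, E i a a) (TT s κ E c) :=
    Commute.sum_left _ _ _ fun i hi => S.D_T hi a c
  exact h1.add_left h2

lemma E_phi (S : GLSys s h κ E) (o : ι) {i : ℕ} (hi : i ∈ s) (m n k l : ι) :
    E i m n * phi o h (TT s κ E) l k = phi o h (shf h (TT s κ E) m n) l k * E i m n := by
  have h1 := S.E_T hi m n k
  have h2 := S.E_T hi m n o
  have h3 := S.hc (E i m n)
  have A : E i m n * (if k = o then -1 else TT s κ E k - h) =
      (if k = o then -1 else shf h (TT s κ E) m n k - h) * E i m n := by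
    split_ifs
    · simp
    · rw [mul_sub, sub_mul, h1, h3]
  have B : E i m n * (if l = o then TT s κ E o + (if k = o then 0 else h) else -1) =
      (if l = o then shf h (TT s κ E) m n o + (if k = o then 0 else h) else -1) * E i m n := by
    split_ifs
    · simp [h2]
    · rw [mul_add, add_mul, h2, h3]
    · simp
  unfold phi
  rw [← mul_assoc, A, mul_assoc, B, mul_assoc]

lemma com_phi (S : GLSys s h κ E) (o : ι) (x : R) (hx : ∀ c, Commute x (TT s κ E c)) (l k : ι) :
    Commute x (phi o h (TT s κ E) l k) := by
  have hh : Commute x h := (S.hc x).symm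
  unfold phi
  refine Commute.mul_right ?_ ?_
  · split_ifs
    · exact (Commute.one_right x).neg_right
    · exact (hx k).sub_right hh
  · split_ifs
    · exact (hx o).add_right (Commute.zero_right x)
    · exact (hx o).add_right hh
    · exact (Commute.one_right x).neg_right

/-- weight zero -/
lemma DD_X (S : GLSys s h κ E) {i j : ℕ} (hi : i ∈ s) (hj : j ∈ s) (hij : i ≠ j) (m n c : ι) :
    Commute (E i m n * E j n m) (E i c c + E j c c) := by
  have h1 := S.E_D hi m n c
  have h2 := S.E_D hj n m c
  have h3 := S.cm i hi j hj hij m n c c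
  have h4 := S.cm i hi j hj hij c c n m
  set d : R := -(if c = m then h else 0) + (if c = n then h else 0) with hd
  have h5 : (-(if c = n then h else 0) + (if c = m then h else 0)) = - d := by rw [hd]; abel
  rw [h5] at h2
  have hdc : ∀ r, d * r = r * d := by
    intro r
    rw [hd]
    split_ifs <;> simp [S.hc]
  unfold Commute SemiconjBy
  rw [mul_add, add_mul]
  rw [mul_assoc _ _ (E i c c), ← h4, ← mul_assoc, h1, mul_assoc _ _ (E j c c), h2, mul_add, ← mul_assoc _ (E j c c), h3,
    ← mul_assoc _ (-d), ← neg_mul_comm, ← hdc]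
  noncomm_ring

lemma X_T (S : GLSys s h κ E) {i j : ℕ} (hi : i ∈ s) (hj : j ∈ s) (hij : i ≠ j) (m n c : ι) :
    Commute (E i m n * E j n m) (TT s κ E c) := by
  unfold TT
  have hj' : j ∈ s.erase i := by simp [hj, Ne.symm hij]
  rw [← Finset.add_sum_erase s _ hi, ← Finset.add_sum_erase _ _ hj', ← add_assoc (E i c c)]
  refine Commute.add_right (S.kc _ _).symm ((S.DD_X hi hj hij m n c).add_right ?_)
  refine Commute.sum_right _ _ _ fun k hk => ?_
  simp only [Finset.mem_erase] at hk
  refine Commute.mul_left ?_ ?_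
  · exact S.cm i hi k hk.2.2 (Ne.symm hk.2.1) _ _ _ _
  · exact S.cm j hj k hk.2.2 (Ne.symm hk.1) _ _ _ _

/-- generator parts -/
noncomputable def RR (z : ℕ → ℂ) (E : ℕ → ι → ι → R) (i j : ℕ) : R :=
  ∑ m, ∑ n, sco (z i) (z j) m n • (E i m n * E j n m)

noncomputable def GG (z : ℕ → ℂ) (s : Finset ℕ) (h : R) (κ : ι → R) (o : ι) (E : ℕ → ι → ι → R) (i : ℕ) : R :=
  ∑ m, ∑ n, sco (z i) 1 m n • (phi o h (TT s κ E) n m * E i m n)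

noncomputable def KK (c : ι → R) (E : ℕ → ι → ι → R) (i : ℕ) : R := ∑ m, c m * E i m m

variable {z : ℕ → ℂ} {o : ι} {c : ι → R}

lemma RR_skew (S : GLSys s h κ E) {i j : ℕ} (hi : i ∈ s) (hj : j ∈ s) (hij : i ≠ j) (hz : z i ≠ z j) :
    RR z E j i = - RR z E i j := by
  unfold RR
  rw [Finset.sum_comm, ← Finset.sum_neg_distrib]
  refine Finset.sum_congr rfl fun m _ => ?_
  rw [← Finset.sum_neg_distrib]
  refine Finset.sum_congr rfl fun n _ => ?_
  rw [sco_skew _ _ hz, neg_smul, S.cm i hi j hj hij]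

lemma com_RR (x : R) (i j : ℕ) (hx : ∀ m n, Commute x (E i m n * E j n m)) : Commute x (RR z E i j) :=
  Commute.sum_right _ _ _ fun m _ => Commute.sum_right _ _ _ fun n _ => (hx m n).smul_right _

lemma com_GG (x : R) (i : ℕ) (hx : ∀ m n, Commute x (phi o h (TT s κ E) n m * E i m n)) :
    Commute x (GG z s h κ o E i) :=
  Commute.sum_right _ _ _ fun m _ => Commute.sum_right _ _ _ fun n _ => (hx m n).smul_right _

lemma com_KK (hc : ∀ m r, c m * r = r * c m) (x : R) (i : ℕ) (hx : ∀ m, Commute x (E i m m)) :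
    Commute x (KK c E i) :=
  Commute.sum_right _ _ _ fun m _ => Commute.mul_right (hc m x).symm (hx m)

lemma K_K (S : GLSys s h κ E) (hc : ∀ m r, c m * r = r * c m) {i j : ℕ} (hi : i ∈ s) (hj : j ∈ s) (hij : i ≠ j) :
    Commute (KK c E i) (KK c E j) :=
  com_KK hc _ _ fun m => (com_KK hc _ _ fun n => S.cm j hj i hi hij.symm _ _ _ _).symm

lemma K_R (S : GLSys s h κ E) (hc : ∀ m r, c m * r = r * c m) {i j k : ℕ} (hi : i ∈ s) (hj : j ∈ s) (hk : k ∈ s)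
    (hij : i ≠ j) (hik : i ≠ k) : Commute (KK c E i) (RR z E j k) :=
  com_RR _ _ _ fun m n => (com_KK hc _ _ fun l => Commute.mul_left
    (S.cm j hj i hi hij.symm _ _ _ _) (S.cm k hk i hi hik.symm _ _ _ _)).symm

lemma KK_R (S : GLSys s h κ E) (hc : ∀ m r, c m * r = r * c m) {i j : ℕ} (hi : i ∈ s) (hj : j ∈ s)
    (hij : i ≠ j) : Commute (KK c E i + KK c E j) (RR z E i j) := by
  refine com_RR _ _ _ fun m n => ?_
  unfold KK
  rw [← Finset.sum_add_distrib]
  refine Commute.sum_left _ _ _ fun l _ => ?_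
  rw [← mul_add]
  exact Commute.mul_left (hc _ _) (S.DD_X hi hj hij m n l).symm

lemma K_G (S : GLSys s h κ E) (hc : ∀ m r, c m * r = r * c m) {i j : ℕ} (hi : i ∈ s) (hj : j ∈ s)
    (hij : i ≠ j) : Commute (KK c E i) (GG z s h κ o E j) :=
  com_GG _ _ fun m n => (com_KK hc _ _ fun l => Commute.mul_left
    (S.com_phi o _ (fun c => S.D_T hi l c) _ _).symm (S.cm j hj i hi hij.symm _ _ _ _)).symm

lemma R_G (S : GLSys s h κ E) {i j k : ℕ} (hi : i ∈ s) (hj : j ∈ s) (hk : k ∈ s)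
    (hij : i ≠ j) (hik : i ≠ k) (hjk : j ≠ k) : Commute (RR z E j k) (GG z s h κ o E i) :=
  com_GG _ _ fun m n => (com_RR _ _ _ fun a b => Commute.mul_left
    (S.com_phi o _ (fun c => S.X_T hj hk hjk a b c) _ _).symm
    (Commute.mul_right (S.cm i hi j hj hij _ _ _ _) (S.cm i hi k hk hik _ _ _ _))).symm

lemma R_R (S : GLSys s h κ E) {i j k l : ℕ} (hi : i ∈ s) (hj : j ∈ s) (hk : k ∈ s) (hl : l ∈ s)
    (hij : i ≠ j) (hil : i ≠ l) (hkj : k ≠ j) (hkl : k ≠ l) : Commute (RR z E i k) (RR z E j l) :=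
  com_RR _ _ _ fun m n => (com_RR _ _ _ fun a b => 
    Commute.mul_left
      (Commute.mul_right (S.cm j hj i hi hij.symm _ _ _ _) (S.cm j hj k hk hkj.symm _ _ _ _))
      (Commute.mul_right (S.cm l hl i hi hil.symm _ _ _ _) (S.cm l hl k hk hkl.symm _ _ _ _))).symm

lemma cybe1 (S : GLSys s h κ E) {i j k : ℕ} (hi : i ∈ s) (hj : j ∈ s) (hk : k ∈ s)
    (hij : i ≠ j) (hik : i ≠ k) (hjk : j ≠ k) (zij : z i ≠ z j) (zik : z i ≠ z k) (zjk : z j ≠ z k) :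
    ⁅RR z E i j, RR z E i k⁆ + ⁅RR z E i j, RR z E j k⁆ + ⁅RR z E i k, RR z E j k⁆ = 0 := by
  have cij := S.cm i hi j hj hij
  have cik := S.cm i hi k hk hik
  have cjk := S.cm j hj k hk hjk
  refine cybe (z i) (z j) (z k) zij zik zjk _ _ _
    (fun m l n => h * (E i m l * E j n m * E k l n)) (fun a n m => h * (E i a n * E j n m * E k m a))
    (fun m => rfl) ?_ ?_ ?_
  · intro m n a l
    have : ⁅E i m n * E j n m, E i a l * E k l a⁆ =
        (E i m n * E i a l - E i a l * E i m n) * (E j n m * E k l a) := by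
      rw [Ring.lie_def, sub_mul]
      congr 1
      · rw [mul_assoc, ← mul_assoc (E j n m), ← cij]; noncomm_ring
      · rw [cjk, mul_assoc, ← mul_assoc (E k l a), ← cik]; noncomm_ring
    rw [this, S.gl i hi, sub_mul]
    congr 1 <;> split_ifs with hh <;> first | (subst hh; noncomm_ring) | simp
  · intro m n a l
    have : ⁅E i m n * E j n m, E j a l * E k l a⁆ =
        E i m n * (E j n m * E j a l - E j a l * E j n m) * E k l a := by
      rw [Ring.lie_def, mul_sub, sub_mul]
      congr 1
      · noncomm_ring
      · rw [mul_assoc (E j a l), ← mul_assoc (E k l a), ← cik, mul_assoc (E i m n), ← cjk, ← mul_assoc,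
          ← mul_assoc, ← cij]; noncomm_ring
    rw [this, S.gl j hj, mul_sub, sub_mul]
    congr 1 <;> split_ifs <;>
      first | (exfalso; order) | (subst_vars; rw [← mul_assoc, ← S.hc]; noncomm_ring) | simp
  · intro m n a l
    have : ⁅E i m n * E k n m, E j a l * E k l a⁆ =
        E i m n * E j a l * (E k n m * E k l a - E k l a * E k n m) := by
      rw [Ring.lie_def, mul_sub]
      congr 1
      · rw [mul_assoc, ← mul_assoc (E k n m), ← cjk]; noncomm_ring
      · rw [mul_assoc (E j a l), ← mul_assoc (E k l a), ← cik, ← mul_assoc, ← mul_assoc, ← cij]; noncomm_ring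
    rw [this, S.gl k hk, mul_sub]
    congr 1 <;> split_ifs <;>
      first | (exfalso; order) | (subst_vars; rw [← mul_assoc, ← S.hc]; noncomm_ring) | simp

lemma cybe2 (S : GLSys s h κ E) {i j : ℕ} (hi : i ∈ s) (hj : j ∈ s)
    (hij : i ≠ j) (zij : z i ≠ z j) (zi : z i ≠ 1) (zj : z j ≠ 1) :
    ⁅RR z E i j, GG z s h κ o E i⁆ + ⁅RR z E i j, GG z s h κ o E j⁆
      + ⁅GG z s h κ o E i, GG z s h κ o E j⁆ = 0 := by
  have cij := S.cm i hi j hj hij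
  have cp : ∀ m n a b, (E i m n * E j n m) * phi o h (TT s κ E) a b = phi o h (TT s κ E) a b * (E i m n * E j n m) :=
    fun m n a b => S.com_phi o _ (fun c => S.X_T hi hj hij m n c) a b
  refine cybe (z i) (z j) 1 zij zi zj _ _ _
    (fun m l n => h * (phi o h (TT s κ E) l n * (E i m l * E j n m)))
    (fun a n m => h * (phi o h (TT s κ E) m a * (E i a n * E j n m)))
    (fun m => rfl) ?_ ?_ ?_
  · intro m n a l
    have : ⁅E i m n * E j n m, phi o h (TT s κ E) l a * E i a l⁆ =
        phi o h (TT s κ E) l a * (E i m n * E i a l - E i a l * E i m n) * E j n m := by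
      rw [Ring.lie_def, mul_sub, sub_mul]
      congr 1
      · rw [← mul_assoc, cp, mul_assoc, mul_assoc, ← cij]; noncomm_ring
      · noncomm_ring
    rw [this, S.gl i hi, mul_sub, sub_mul]
    congr 1 <;> split_ifs with hh <;> first | (subst hh; rw [← mul_assoc, ← S.hc]; noncomm_ring) | simp
  · intro m n a l
    have : ⁅E i m n * E j n m, phi o h (TT s κ E) l a * E j a l⁆ =
        phi o h (TT s κ E) l a * E i m n * (E j n m * E j a l - E j a l * E j n m) := by
      rw [Ring.lie_def, mul_sub]
      congr 1
      · rw [← mul_assoc, cp]; noncomm_ring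
      · rw [mul_assoc, ← mul_assoc (E j a l), ← cij]; noncomm_ring
    rw [this, S.gl j hj, mul_sub]
    congr 1 <;> split_ifs <;>
      first | (exfalso; order) | (subst_vars; rw [← mul_assoc, ← S.hc]; noncomm_ring) | simp
  · intro m n a l
    have : ⁅phi o h (TT s κ E) n m * E i m n, phi o h (TT s κ E) l a * E j a l⁆ =
        (phi o h (TT s κ E) n m * phi o h (shf h (TT s κ E) m n) l a
          - phi o h (TT s κ E) l a * phi o h (shf h (TT s κ E) a l) n m) * (E i m n * E j a l) := by
      rw [Ring.lie_def, sub_mul]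
      congr 1
      · rw [mul_assoc, ← mul_assoc (E i m n), S.E_phi o hi]; noncomm_ring
      · rw [mul_assoc, ← mul_assoc (E j a l), S.E_phi o hj, cij]; noncomm_ring
    rw [this, phi_idR o h _ S.hc (fun m n => S.T_T m n), sub_mul]
    congr 1 <;> split_ifs with hh <;> first | (subst hh; noncomm_ring) | simp

theorem main (S : GLSys s h κ E) (hc : ∀ m r, c m * r = r * c m) {i j : ℕ} (hi : i ∈ s) (hj : j ∈ s)
    (hij : i ≠ j) (zd : ∀ i ∈ s, ∀ j ∈ s, i ≠ j → z i ≠ z j) (z1 : ∀ i ∈ s, z i ≠ 1) :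
    Commute (KK c E i + ∑ k ∈ s.erase i, RR z E i k + GG z s h κ o E i)
      (KK c E j + ∑ k ∈ s.erase j, RR z E j k + GG z s h κ o E j) := by
  have hj' : j ∈ s.erase i := by simp [hj, Ne.symm hij]
  have hi' : i ∈ s.erase j := by simp [hi, hij]
  rw [← Finset.add_sum_erase _ _ hj', ← Finset.add_sum_erase _ _ hi', Finset.erase_right_comm,
    S.RR_skew hi hj hij (zd i hi j hj hij)]
  set s' := (s.erase j).erase i with hs'
  have ms : ∀ k ∈ s', k ∈ s ∧ i ≠ k ∧ j ≠ k := by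
    intro k hk
    simp only [hs', Finset.mem_erase] at hk
    exact ⟨hk.2.2, Ne.symm hk.1, Ne.symm hk.2.1⟩
  have f1 := S.K_K hc hi hj hij
  have f2 := S.KK_R (z := z) hc hi hj hij
  have f3 : Commute (KK c E i) (∑ k ∈ s', RR z E j k) := Commute.sum_right _ _ _ fun k hk =>
    S.K_R hc hi hj (ms k hk).1 hij (ms k hk).2.1
  have f4 : Commute (∑ k ∈ s', RR z E i k) (KK c E j) := (Commute.sum_right _ _ _ fun k hk =>
    S.K_R hc hj hi (ms k hk).1 hij.symm (ms k hk).2.2).symm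
  have f5 := S.K_G (z := z) (o := o) hc hi hj hij
  have f6 := S.K_G (z := z) (o := o) hc hj hi hij.symm
  have f7 : Commute (∑ k ∈ s', RR z E i k) (GG z s h κ o E j) := Commute.sum_left _ _ _ fun k hk =>
    S.R_G hj hi (ms k hk).1 hij.symm (ms k hk).2.2 (ms k hk).2.1
  have f8 : Commute (∑ k ∈ s', RR z E j k) (GG z s h κ o E i) := Commute.sum_left _ _ _ fun k hk =>
    S.R_G hi hj (ms k hk).1 hij (ms k hk).2.1 (ms k hk).2.2
  have f9 := S.cybe2 (o := o) hi hj hij (zd i hi j hj hij) (z1 i hi) (z1 j hj)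
  have f10 : ⁅RR z E i j, ∑ k ∈ s', RR z E i k⁆ + ⁅RR z E i j, ∑ k ∈ s', RR z E j k⁆
      + ⁅∑ k ∈ s', RR z E i k, ∑ k ∈ s', RR z E j k⁆ = 0 := by
    have : ⁅∑ k ∈ s', RR z E i k, ∑ k ∈ s', RR z E j k⁆ = ∑ k ∈ s', ⁅RR z E i k, RR z E j k⁆ := by
      rw [bsl]
      refine Finset.sum_congr rfl fun k hk => ?_
      rw [bsr]
      refine Finset.sum_eq_single_of_mem k hk fun l hl hlk => ?_
      rw [Ring.lie_def, sub_eq_zero]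
      exact S.R_R hi hj (ms k hk).1 (ms l hl).1 hij (ms l hl).2.1 (ms k hk).2.2.symm hlk.symm
    rw [this, bsr, bsr, ← Finset.sum_add_distrib, ← Finset.sum_add_distrib]
    refine Finset.sum_eq_zero fun k hk => ?_
    exact S.cybe1 hi hj (ms k hk).1 hij (ms k hk).2.1 (ms k hk).2.2 (zd i hi j hj hij)
      (zd i hi k (ms k hk).1 (ms k hk).2.1) (zd j hj k (ms k hk).1 (ms k hk).2.2)
  generalize (∑ k ∈ s', RR z E i k) = A at *
  generalize (∑ k ∈ s', RR z E j k) = B at *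
  generalize RR z E i j = r at *
  generalize GG z s h κ o E i = g at *
  generalize GG z s h κ o E j = g' at *
  generalize KK c E i = u at *
  generalize KK c E j = v at *
  unfold Commute SemiconjBy at *
  rw [← sub_eq_zero] at f1 f2 f3 f4 f5 f6 f7 f8 ⊢
  simp only [Ring.lie_def] at f9 f10
  calc _ = (u * v - v * u) - ((u + v) * r - r * (u + v)) + (u * B - B * u) + (A * v - v * A)
      + (u * g' - g' * u) - (v * g - g * v) + (A * g' - g' * A) - (B * g - g * B)
      + (r * g - g * r + (r * g' - g' * r) + (g * g' - g' * g))
      + (r * A - A * r + (r * B - B * r) + (A * B - B * A)) := by noncomm_ring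
    _ = 0 := by rw [f1, f2, f3, f4, f5, f6, f7, f8, f9, f10]; simp

end GLSys

lemma site_gl (o : ι) (h θ : R) (q p : ι → R) (hc : ∀ r, h * r = r * h) (θc : ∀ r, θ * r = r * θ)
    (hqq : ∀ m n, m ≠ o → n ≠ o → q m * q n = q n * q m)
    (hpp : ∀ m n, m ≠ o → n ≠ o → p m * p n = p n * p m)
    (hpq : ∀ m n, m ≠ o → n ≠ o → p m * q n - q n * p m = if n = m then h else 0)
    (hp : p o = -1) (hq : q o = θ + ∑ m ∈ Finset.univ.erase o, q m * p m) (m n k l : ι) :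
    (q m * p n) * (q k * p l) - (q k * p l) * (q m * p n) =
      (if n = k then h * (q m * p l) else 0) - (if l = m then h * (q k * p n) else 0) := by
  have pp : ∀ m n, p m * p n = p n * p m := by
    intro m n
    by_cases h1 : m = o
    · subst h1; rw [hp]; simp
    by_cases h2 : n = o
    · subst h2; rw [hp]; simp
    exact hpp m n h1 h2
  have pq1 : ∀ n k, k ≠ o → p n * q k = q k * p n + if n = k then h else 0 := by
    intro n k hk
    by_cases h1 : n = o
    · subst h1; rw [hp]; simp [Ne.symm hk]
    have := hpq n k h1 hk
    rw [sub_eq_iff_eq_add] at this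
    rw [this, add_comm]
    simp [eq_comm]
  have pq0 : ∀ n, p n * q o = q o * p n + if n = o then 0 else h * p n := by
    intro n
    by_cases h1 : n = o
    · subst h1; rw [hp]; simp
    have e : ∀ m ∈ Finset.univ.erase o, p n * (q m * p m) = q m * p m * p n + if m = n then h * p n else 0 := by
      intro m hm
      rw [← mul_assoc, pq1 n m (Finset.ne_of_mem_erase hm), add_mul, mul_assoc, pp n m, ← mul_assoc]
      by_cases hmn : m = n
      · subst hmn; simp
      · simp [hmn, Ne.symm hmn]
    rw [hq, mul_add, Finset.mul_sum, Finset.sum_congr rfl e, Finset.sum_add_distrib, Finset.sum_ite_eq',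
      if_pos (by simp [h1]), if_neg h1, ← θc, add_mul, Finset.sum_mul, add_assoc]
  have qq0 : ∀ k, k ≠ o → q o * q k = q k * q o + h * q k := by
    intro k hk
    have e : ∀ m ∈ Finset.univ.erase o, (q m * p m) * q k = q k * (q m * p m) + if m = k then h * q k else 0 := by
      intro m hm
      rw [mul_assoc, pq1 m k hk, mul_add, ← mul_assoc, hqq m k (Finset.ne_of_mem_erase hm) hk, mul_assoc]
      by_cases hmn : m = k
      · subst hmn; simp [hc]
      · simp [hmn]
    rw [hq, add_mul, Finset.sum_mul, Finset.sum_congr rfl e, Finset.sum_add_distrib, Finset.sum_ite_eq',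
      if_pos (by simp [hk]), θc, mul_add, Finset.mul_sum, add_assoc]
  have i1 : ∀ (c : Prop) [Decidable c] (x y : R), x * (if c then h else 0) * y = if c then h * (x * y) else 0 := by
    intro c _ x y
    split_ifs
    · rw [← hc, mul_assoc]
    · simp
  by_cases hm : m = o <;> by_cases hk : k = o
  · subst hm; subst hk
    have a : ∀ n l, q k * p n * (q k * p l) = q k * q k * p n * p l + (if n = k then 0 else h * (q k * p n * p l)) := by
      intro n l
      rw [mul_assoc, ← mul_assoc (p n), pq0, add_mul, mul_add]
      congr 1
      · noncomm_ring
      · split_ifs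
        · simp
        · rw [mul_assoc, ← mul_assoc, ← hc]; noncomm_ring
    rw [a, a]
    have b : ∀ x, x * p n * p l = x * p l * p n := by intro x; rw [mul_assoc, pp, mul_assoc]
    rw [b, b]
    by_cases h1 : n = k <;> by_cases h2 : l = k <;> simp [h1, h2, hp]
  · subst hm
    have a1 : q m * p n * (q k * p l) = q m * q k * p n * p l + if n = k then h * (q m * p l) else 0 := by
      rw [← mul_assoc, mul_assoc (q m), pq1 n k hk, mul_add, add_mul, i1]
      congr 1
      noncomm_ring
    have a2 : q k * p l * (q m * p n) = q k * q m * p l * p n + if l = m then 0 else h * (q k * p l * p n) := by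
      rw [← mul_assoc, mul_assoc (q k), pq0, mul_add, add_mul]
      congr 1
      · noncomm_ring
      · split_ifs
        · simp
        · rw [← mul_assoc, ← hc]; noncomm_ring
    rw [a1, a2, qq0 k hk, mul_assoc _ (p n), pp n l]
    by_cases h2 : l = m
    · simp [h2, hp]; noncomm_ring
    · simp [h2]; noncomm_ring
  · subst hk
    have a1 : q m * p n * (q k * p l) = q m * q k * p n * p l + if n = k then 0 else h * (q m * p n * p l) := by
      rw [← mul_assoc, mul_assoc (q m), pq0, mul_add, add_mul]
      congr 1
      · noncomm_ring
      · split_ifs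
        · simp
        · rw [← mul_assoc, ← hc]; noncomm_ring
    have a2 : q k * p l * (q m * p n) = q k * q m * p l * p n + if l = m then h * (q k * p n) else 0 := by
      rw [← mul_assoc, mul_assoc (q k), pq1 l m hm, mul_add, add_mul, i1]
      congr 1
      noncomm_ring
    rw [a1, a2, qq0 m hm, mul_assoc _ (p l), pp l n]
    by_cases h2 : n = k
    · simp [h2, hp]; noncomm_ring
    · simp [h2, pp l n]; noncomm_ring
  · have a : ∀ m n k l, k ≠ o → q m * p n * (q k * p l) = q m * q k * p n * p l + if n = k then h * (q m * p l) else 0 := by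
      intro m n k l hk
      rw [← mul_assoc, mul_assoc (q m), pq1 n k hk, mul_add, add_mul, i1]
      congr 1
      noncomm_ring
    rw [a m n k l hk, a k l m n hm, hqq m k hm hk, mul_assoc _ (p n), pp n l]
    noncomm_ring

open GLSys in
lemma ham {s : Finset ℕ} {h : R} {κ : ι → R} {E : ℕ → ι → ι → R} (S : GLSys s h κ E) (o : ι) (z : ℕ → ℂ)
    (e : ι → R) (θ : R) {i : ℕ} (hi : i ∈ s) (hθ : ∑ m, E i m m = - θ) :
    (∑ n, e n * E i n n) + ((∑ n, ∑ m, if m < n then phi o h (TT s κ E) n m * E i m n else 0) +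
      ((∑ n, ∑ m, if m < n then E i m m * E i n n else 0) +
      ∑ j ∈ s.erase i, ∑ n, ∑ m, if m < n then E i m n * E j n m else 0))
    + (z i - 1)⁻¹ • (∑ m, ∑ n, phi o h (TT s κ E) n m * E i m n)
    + (∑ j ∈ s.erase i, (z j / (z i - z j)) • ∑ m, ∑ n, E i m n * E j n m)
    = (KK (fun m => e m + (1 / 2 : ℂ) • κ m - (1 / 2 : ℂ) • (if m = o then 0 else h)) E i
      + ∑ k ∈ s.erase i, RR z E i k + GG z s h κ o E i) + (1 / 2 : ℂ) • (θ * θ) := by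
  have hR : ∀ j, RR z E i j = (z j / (z i - z j)) • (∑ m, ∑ n, E i m n * E j n m)
      + (∑ n, ∑ m, if m < n then E i m n * E j n m else 0) + (1 / 2 : ℂ) • ∑ m, E i m m * E j m m := by
    intro j
    unfold RR sco
    rw [Finset.sum_comm (f := fun n m => if m < n then E i m n * E j n m else 0)]
    simp only [add_smul, ite_smul, one_smul, zero_smul, Finset.sum_add_distrib, Finset.smul_sum,
      Finset.sum_ite_eq, Finset.mem_univ, if_true]
  have hG : GG z s h κ o E i = (z i - 1)⁻¹ • (∑ m, ∑ n, phi o h (TT s κ E) n m * E i m n)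
      + (∑ n, ∑ m, if m < n then phi o h (TT s κ E) n m * E i m n else 0)
      + (1 / 2 : ℂ) • ∑ m, phi o h (TT s κ E) m m * E i m m := by
    unfold GG sco
    rw [Finset.sum_comm (f := fun n m => if m < n then phi o h (TT s κ E) n m * E i m n else 0)]
    simp only [add_smul, ite_smul, one_smul, zero_smul, Finset.sum_add_distrib, Finset.smul_sum,
      Finset.sum_ite_eq, Finset.mem_univ, if_true, one_div]
  have cD : ∀ m n, E i m m * E i n n = E i n n * E i m m := by
    intro m n
    have := S.gl i hi m m n n
    rw [← sub_eq_zero, this]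
    by_cases hmn : m = n
    · subst hmn; simp
    · simp [hmn, Ne.symm hmn]
  have hO : θ * θ = (2 : ℂ) • (∑ n, ∑ m, if m < n then E i m m * E i n n else 0) + ∑ m, E i m m * E i m m := by
    have h1 : θ * θ = ∑ m, ∑ n, E i m m * E i n n := by
      rw [← Finset.sum_mul_sum, hθ]; simp
    have h2 : ∀ m n, E i m m * E i n n = (if m < n then E i m m * E i n n else 0) +
        (if n < m then E i n n * E i m m else 0) + (if m = n then E i m m * E i n n else 0) := by
      intro m n
      rcases lt_trichotomy m n with hh | hh | hh
      · simp [hh, hh.not_gt, hh.ne]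
      · subst hh; simp
      · simp [hh, hh.not_gt, hh.ne', cD m n]
    rw [h1, Finset.sum_congr rfl fun m _ => Finset.sum_congr rfl fun n _ => h2 m n]
    simp only [Finset.sum_add_distrib, Finset.sum_ite_eq, Finset.mem_univ, if_true]
    rw [Finset.sum_comm, two_smul]
  have hF : (∑ j ∈ s.erase i, ∑ m, E i m m * E j m m) + ∑ m, phi o h (TT s κ E) m m * E i m m
      = - (∑ m, κ m * E i m m) - (∑ m, E i m m * E i m m) + ∑ m, (if m = o then 0 else h) * E i m m := by
    rw [Finset.sum_comm, ← Finset.sum_add_distrib, ← Finset.sum_neg_distrib, ← Finset.sum_sub_distrib,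
      ← Finset.sum_add_distrib]
    refine Finset.sum_congr rfl fun m _ => ?_
    have hT : ∑ j ∈ s.erase i, E j m m = TT s κ E m - κ m - E i m m := by
      unfold TT
      rw [← Finset.add_sum_erase s _ hi]; abel
    rw [← Finset.mul_sum, hT, mul_sub, mul_sub, S.D_T hi m m, ← S.kc]
    unfold phi
    split_ifs with hm
    · subst hm; noncomm_ring
    · noncomm_ring
  have hK : KK (fun m => e m + (1 / 2 : ℂ) • κ m - (1 / 2 : ℂ) • (if m = o then 0 else h)) E i =
      (∑ n, e n * E i n n) + (1 / 2 : ℂ) • (∑ m, κ m * E i m m)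
      - (1 / 2 : ℂ) • ∑ m, (if m = o then 0 else h) * E i m m := by
    unfold KK
    simp only [sub_mul, add_mul, smul_mul_assoc, Finset.sum_add_distrib, Finset.sum_sub_distrib, Finset.smul_sum]
  rw [hG, hK, Finset.sum_congr rfl fun k _ => hR k, hO]
  simp only [Finset.sum_add_distrib, ← Finset.smul_sum]
  have hF' : ∑ m, (if m = o then 0 else h) * E i m m = (∑ j ∈ s.erase i, ∑ m, E i m m * E j m m) + (∑ m, phi o h (TT s κ E) m m * E i m m)
      + (∑ m, κ m * E i m m) + (∑ m, E i m m * E i m m) := by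
    rw [hF]; abel
  rw [hF']
  module

lemma sum_rng (L : ℕ) (n : Fin L) (f : ℕ → R) :
    ∑ m ∈ Finset.range (n : ℕ), f m = ∑ m : Fin L, if m < n then f m else 0 := by
  have := Finset.sum_range (n := L) (fun m => if m < (n : ℕ) then f m else 0)
  simp only [Fin.lt_def]
  rw [← this, ← Finset.sum_filter]
  congr 1
  ext x
  simp only [Finset.mem_range, Finset.mem_filter]
  omega

lemma sum_icc (L : ℕ) (o : Fin L) (ho : (o : ℕ) = 0) (f : ℕ → R) :
    ∑ m ∈ Finset.Icc 1 (L - 1), f m = ∑ m ∈ Finset.univ.erase o, f (m : ℕ) := by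
  have h1 : Finset.range L = insert 0 (Finset.Icc 1 (L - 1)) := by
    ext x
    have := o.2
    simp only [Finset.mem_range, Finset.mem_insert, Finset.mem_Icc]
    omega
  have h2 := Finset.sum_range (n := L) f
  rw [h1, Finset.sum_insert (by simp), ← Finset.add_sum_erase _ _ (Finset.mem_univ o), ho] at h2
  exact add_left_cancel h2

end FST

theorem stmt4 {R : Type*} [Ring R] [Algebra ℂ R]
    (L N : ℕ) (hL : 2 ≤ L) (hN : 1 ≤ N)
    (hbar : R) (e κ θ : ℕ → R) (q p : ℕ → ℕ → R)
    (hbar_central : ∀ r : R, hbar * r = r * hbar)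
    (he_central : ∀ n, n ≤ L - 1 → ∀ r : R, e n * r = r * e n)
    (hκ_central : ∀ n, n ≤ L - 1 → ∀ r : R, κ n * r = r * κ n)
    (hθ_central : ∀ j, j ≤ N → ∀ r : R, θ j * r = r * θ j)
    (he_sum : ∑ m ∈ Finset.range L, e m = algebraMap ℂ R (((L : ℂ) - 1) / 2))
    (hκ_sum : ∑ m ∈ Finset.range L, κ m = ∑ i ∈ Finset.range (N + 1), θ i)
    (hpq : ∀ m n i j, 1 ≤ m → m ≤ L - 1 → 1 ≤ n → n ≤ L - 1 →
      1 ≤ i → i ≤ N → 1 ≤ j → j ≤ N →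
      p m j * q n i - q n i * p m j = if n = m ∧ i = j then hbar else 0)
    (hqq : ∀ m n i j, 1 ≤ m → m ≤ L - 1 → 1 ≤ n → n ≤ L - 1 →
      1 ≤ i → i ≤ N → 1 ≤ j → j ≤ N → q m i * q n j = q n j * q m i)
    (hpp : ∀ m n i j, 1 ≤ m → m ≤ L - 1 → 1 ≤ n → n ≤ L - 1 →
      1 ≤ i → i ≤ N → 1 ≤ j → j ≤ N → p m i * p n j = p n j * p m i)
    (hq0 : ∀ i, 1 ≤ i → i ≤ N →
      q 0 i = θ i + ∑ m ∈ Finset.Icc 1 (L - 1), q m i * p m i)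
    (hp0 : ∀ i, 1 ≤ i → i ≤ N → p 0 i = -1)
    (hqm0 : ∀ m, 1 ≤ m → m ≤ L - 1 → q m 0 = -1)
    (hpm0 : ∀ m, 1 ≤ m → m ≤ L - 1 →
      p m 0 = κ m + ∑ i ∈ Finset.Icc 1 N, q m i * p m i)
    (hq00 : q 0 0 = κ 0 - ∑ i ∈ Finset.Icc 1 N, θ i
      - ∑ i ∈ Finset.Icc 1 N, ∑ m ∈ Finset.Icc 1 (L - 1), q m i * p m i)
    (hp00 : p 0 0 = -1)
    (z : ℕ → ℂ)
    (hz_distinct : ∀ i j, 1 ≤ i → i ≤ N → 1 ≤ j → j ≤ N → i ≠ j → z i ≠ z j)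
    (hz0 : ∀ i, 1 ≤ i → i ≤ N → z i ≠ 0)
    (hz1 : ∀ i, 1 ≤ i → i ≤ N → z i ≠ 1)
    (H : ℕ → R)
    (hH : ∀ i, 1 ≤ i → i ≤ N → z i • H i =
      (∑ n ∈ Finset.range L, e n * q n i * p n i)
      + (∑ j ∈ Finset.range (N + 1), ∑ n ∈ Finset.range L, ∑ m ∈ Finset.range n,
          q m i * p m j * q n j * p n i)
      + (z i - 1)⁻¹ • (∑ m ∈ Finset.range L, ∑ n ∈ Finset.range L,
          q m i * p m 0 * q n 0 * p n i)
      + (∑ j ∈ (Finset.Icc 1 N).erase i, (z j / (z i - z j)) •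
          (∑ m ∈ Finset.range L, ∑ n ∈ Finset.range L, q m i * p n i * q n j * p m j))
      + θ i * (e 0 + κ 0 - (∑ j ∈ Finset.Icc 1 N, θ j)
          - ∑ j ∈ (Finset.Icc 1 N).erase i, (z j / (z i - z j)) • θ j)) :
    ∀ i j, 1 ≤ i → i ≤ N → 1 ≤ j → j ≤ N → H i * H j = H j * H i := by
  have hL0 : 0 < L := by omega
  let o : Fin L := ⟨0, hL0⟩
  have ho : ((o : Fin L) : ℕ) = 0 := rfl
  have hnz : ∀ m : Fin L, m ≠ o → 1 ≤ (m : ℕ) ∧ (m : ℕ) ≤ L - 1 := by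
    intro m hm
    have h1 : (m : ℕ) ≠ 0 := fun h => hm (Fin.ext h)
    have := m.2
    omega
  have hle : ∀ m : Fin L, (m : ℕ) ≤ L - 1 := fun m => by have := m.2; omega
  let s : Finset ℕ := Finset.Icc 1 N
  have hs : ∀ i ∈ s, 1 ≤ i ∧ i ≤ N := fun i hi => Finset.mem_Icc.1 hi
  let E : ℕ → Fin L → Fin L → R := fun i m n => q m i * p n i
  let κ' : Fin L → R := fun m => κ m
  have q0 : ∀ i ∈ s, q 0 i = θ i + ∑ m ∈ Finset.univ.erase o, q (m : Fin L) i * p m i := by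
    intro i hi
    rw [hq0 i (hs i hi).1 (hs i hi).2, sum_icc L o ho (fun m => q m i * p m i)]
  -- cross-site commutation
  have cross1 : ∀ i ∈ s, ∀ j ∈ s, i ≠ j → ∀ m n : Fin L, m ≠ o → n ≠ o →
      Commute (q m i) (q n j) ∧ Commute (q m i) (p n j) ∧ Commute (p m i) (q n j)
        ∧ Commute (p m i) (p n j) := by
    intro i hi j hj hij m n hm hn
    obtain ⟨i1, i2⟩ := hs i hi
    obtain ⟨j1, j2⟩ := hs j hj
    obtain ⟨m1, m2⟩ := hnz m hm
    obtain ⟨n1, n2⟩ := hnz n hn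
    refine ⟨hqq m n i j m1 m2 n1 n2 i1 i2 j1 j2, ?_, ?_, hpp m n i j m1 m2 n1 n2 i1 i2 j1 j2⟩
    · have := hpq n m i j n1 n2 m1 m2 i1 i2 j1 j2
      rw [if_neg (fun h => hij h.2), sub_eq_zero] at this
      exact this.symm
    · have := hpq m n j i m1 m2 n1 n2 j1 j2 i1 i2
      rw [if_neg (fun h => hij h.2.symm), sub_eq_zero] at this
      exact this
  have cross2 : ∀ i ∈ s, ∀ j ∈ s, i ≠ j → ∀ m n : Fin L, m ≠ o →
      Commute (q m i) (q n j) ∧ Commute (q m i) (p n j) ∧ Commute (p m i) (q n j)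
        ∧ Commute (p m i) (p n j) := by
    intro i hi j hj hij m n hm
    by_cases hn : n = o
    · have e1 : p n j = -1 := by rw [hn, ho]; exact hp0 j (hs j hj).1 (hs j hj).2
      have e2 : ∀ x : R, (∀ k : Fin L, k ≠ o → Commute x (q k j) ∧ Commute x (p k j)) →
          Commute x (q n j) := by
        intro x hx
        rw [hn, ho, q0 j hj]
        refine Commute.add_right (hθ_central j (hs j hj).2 x).symm ?_
        refine Commute.sum_right _ _ _ fun k hk => ?_
        have := hx k (Finset.ne_of_mem_erase hk)
        exact this.1.mul_right this.2
      rw [e1]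
      refine ⟨e2 _ fun k hk => ?_, (Commute.one_right _).neg_right, e2 _ fun k hk => ?_,
        (Commute.one_right _).neg_right⟩
      · have := cross1 i hi j hj hij m k hm hk
        exact ⟨this.1, this.2.1⟩
      · have := cross1 i hi j hj hij m k hm hk
        exact ⟨this.2.2.1, this.2.2.2⟩
    · exact cross1 i hi j hj hij m n hm hn
  have cross3 : ∀ i ∈ s, ∀ j ∈ s, i ≠ j → ∀ m n : Fin L,
      Commute (q m i) (q n j) ∧ Commute (q m i) (p n j) ∧ Commute (p m i) (q n j)
        ∧ Commute (p m i) (p n j) := by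
    intro i hi j hj hij m n
    by_cases hm : m = o
    · have e1 : p m i = -1 := by rw [hm, ho]; exact hp0 i (hs i hi).1 (hs i hi).2
      have e2 : ∀ x : R, (∀ k : Fin L, k ≠ o → Commute (q k i) x ∧ Commute (p k i) x) →
          Commute (q m i) x := by
        intro x hx
        rw [hm, ho, q0 i hi]
        refine Commute.add_left (hθ_central i (hs i hi).2 x) ?_
        refine Commute.sum_left _ _ _ fun k hk => ?_
        have := hx k (Finset.ne_of_mem_erase hk)
        exact this.1.mul_left this.2
      rw [e1]
      refine ⟨e2 _ fun k hk => ?_, e2 _ fun k hk => ?_, (Commute.one_left _).neg_left, 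
        (Commute.one_left _).neg_left⟩
      · have := cross2 i hi j hj hij k n hk
        exact ⟨this.1, this.2.2.1⟩
      · have := cross2 i hi j hj hij k n hk
        exact ⟨this.2.1, this.2.2.2⟩
    · exact cross2 i hi j hj hij m n hm
  have S : GLSys s hbar κ' E := by
    refine ⟨hbar_central, fun m r => hκ_central m (hle m) r, ?_, ?_⟩
    · intro i hi m n k l
      obtain ⟨i1, i2⟩ := hs i hi
      refine site_gl o hbar (θ i) (fun m : Fin L => q m i) (fun m : Fin L => p m i) hbar_central
        (hθ_central i i2) ?_ ?_ ?_ (hp0 i i1 i2) (q0 i hi) m n k l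
      · intro m n hm hn
        exact hqq m n i i (hnz m hm).1 (hnz m hm).2 (hnz n hn).1 (hnz n hn).2 i1 i2 i1 i2
      · intro m n hm hn
        exact hpp m n i i (hnz m hm).1 (hnz m hm).2 (hnz n hn).1 (hnz n hn).2 i1 i2 i1 i2
      · intro m n hm hn
        have := hpq m n i i (hnz m hm).1 (hnz m hm).2 (hnz n hn).1 (hnz n hn).2 i1 i2 i1 i2
        simpa [Fin.ext_iff] using this
    · intro i hi j hj hij m n k l
      have a := cross3 i hi j hj hij m k
      have b := cross3 i hi j hj hij m l
      have c := cross3 i hi j hj hij n k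
      have d := cross3 i hi j hj hij n l
      exact (a.1.mul_right b.2.1).mul_left (c.2.2.1.mul_right d.2.2.2)
  -- the gauge fixed site
  have pT : ∀ m : Fin L, m ≠ o → p m 0 = TT s κ' E m := fun m hm =>
    hpm0 m (hnz m hm).1 (hnz m hm).2
  have qT : q 0 0 = TT s κ' E o := by
    have e1 : ∀ i ∈ s, E i o o = - (θ i + ∑ m ∈ Finset.Icc 1 (L - 1), q m i * p m i) := by
      intro i hi
      change q 0 i * p 0 i = _
      rw [hp0 i (hs i hi).1 (hs i hi).2, hq0 i (hs i hi).1 (hs i hi).2]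
      simp
    unfold TT
    rw [Finset.sum_congr rfl e1, hq00, Finset.sum_neg_distrib, Finset.sum_add_distrib]
    change _ = κ 0 + _
    abel
  have hF : ∀ i ∈ s, ∀ m n : Fin L, q m i * p m 0 * q n 0 * p n i =
      phi o hbar (TT s κ' E) n m * E i m n := by
    intro i hi m n
    have pi0 : p 0 i = -1 := hp0 i (hs i hi).1 (hs i hi).2
    have qE : ∀ m : Fin L, q m i = - E i m o := by
      intro m
      change q m i = -(q m i * p 0 i)
      rw [pi0]; simp
    have A : q m i * p m 0 = (if m = o then -1 else TT s κ' E m - hbar) * q m i := by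
      by_cases hm : m = o
      · rw [if_pos hm, hm, ho, hp00]; simp
      · rw [if_neg hm, pT m hm, qE m, neg_mul, S.E_T hi]
        unfold shf
        simp [hm]
    have B : q m i * q n 0 * p n i =
        (if n = o then TT s κ' E o + (if m = o then 0 else hbar) else -1) * E i m n := by
      by_cases hn : n = o
      · subst hn
        rw [if_pos rfl, ho, qT, qE m, neg_mul, S.E_T hi, pi0]
        unfold shf
        by_cases hm : m = o
        · simp [hm]
        · simp [hm, Ne.symm hm]
      · rw [if_neg hn, hqm0 n (hnz n hn).1 (hnz n hn).2]
        simp [E]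
    rw [A, mul_assoc, mul_assoc, ← mul_assoc (q m i), B]
    unfold phi
    rw [mul_assoc]
  let e' : Fin L → R := fun m => e m
  let c : Fin L → R := fun m => e' m + (1 / 2 : ℂ) • κ' m - (1 / 2 : ℂ) • (if m = o then 0 else hbar)
  have hcc : ∀ m r, c m * r = r * c m := by
    intro m r
    have h1 := he_central m (hle m) r
    have h2 := hκ_central m (hle m) r
    have h3 := hbar_central r
    simp only [c, e', κ']
    split_ifs <;> simp [add_mul, sub_mul, mul_add, mul_sub, h1, h2, h3]
  have hW : ∀ i ∈ s, ∃ W : R, (∀ r, Commute W r) ∧ z i • H i =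
      (GLSys.KK c E i + ∑ k ∈ s.erase i, GLSys.RR z E i k + GLSys.GG z s hbar κ' o E i) + W := by
    intro i hi
    obtain ⟨i1, i2⟩ := hs i hi
    have pi0 : p 0 i = -1 := hp0 i i1 i2
    have htr : ∑ m, E i m m = - θ i := by
      rw [← Finset.add_sum_erase _ _ (Finset.mem_univ o)]
      change q 0 i * p 0 i + _ = _
      rw [pi0, q0 i hi, mul_neg_one, neg_add, add_assoc, neg_add_cancel, add_zero]
    have key := ham S o z e' (θ i) hi htr
    have θc : ∀ j, j ≤ N → ∀ r, Commute (θ j) r := fun j hj r => hθ_central j hj r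
    refine ⟨(1 / 2 : ℂ) • (θ i * θ i) + θ i * (e 0 + κ 0 - (∑ j ∈ Finset.Icc 1 N, θ j)
          - ∑ j ∈ (Finset.Icc 1 N).erase i, (z j / (z i - z j)) • θ j), ?_, ?_⟩
    · intro r
      refine Commute.add_left (Commute.smul_left ((θc i i2 r).mul_left (θc i i2 r)) _) ?_
      refine (θc i i2 r).mul_left (Commute.sub_left (Commute.sub_left (Commute.add_left
        (he_central 0 (by omega) r) (hκ_central 0 (by omega) r)) ?_) ?_)
      · exact Commute.sum_left _ _ _ fun j hj => θc j (hs j hj).2 r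
      · exact Commute.sum_left _ _ _ fun j hj => (θc j (hs j (Finset.mem_of_mem_erase hj)).2 r).smul_left _
    · rw [← add_assoc, ← key, hH i i1 i2]
      congr 1
      have hr : Finset.range (N + 1) = insert 0 s := by
        ext x
        simp only [s, Finset.mem_range, Finset.mem_insert, Finset.mem_Icc]
        omega
      have t0 : ∀ j, ∑ n ∈ Finset.range L, ∑ m ∈ Finset.range n, q m i * p m j * q n j * p n i
          = ∑ n : Fin L, ∑ m : Fin L, if m < n then q m i * p m j * q n j * p n i else 0 := by
        intro j
        rw [Finset.sum_range]
        refine Finset.sum_congr rfl fun n _ => ?_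
        rw [sum_rng L n (fun m => q m i * p m j * q n j * p n i)]
      congr 1
      · congr 1
        · congr 1
          · rw [Finset.sum_range]
            refine Finset.sum_congr rfl fun n _ => ?_
            rw [mul_assoc]
          · rw [hr, Finset.sum_insert (by simp [s]), ← Finset.add_sum_erase s _ hi]
            simp only [t0]
            congr 1
            · simp only [hF i hi]
            · congr 1
              · refine Finset.sum_congr rfl fun n _ => Finset.sum_congr rfl fun m _ => ?_
                simp only [E, mul_assoc]
              · refine Finset.sum_congr rfl fun j hj => Finset.sum_congr rfl fun n _ =>
                  Finset.sum_congr rfl fun m _ => ?_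
                obtain ⟨hji, hj⟩ := Finset.mem_erase.1 hj
                obtain ⟨j1, j2⟩ := hs j hj
                split_ifs with hmn
                · have hn : n ≠ o := by
                    intro h
                    rw [h, Fin.lt_def, ho] at hmn
                    omega
                  have hpqj : p m j * q n j = q n j * p m j := by
                    by_cases hm : m = o
                    · rw [hm, ho, hp0 j j1 j2]; simp
                    · have := hpq m n j j (hnz m hm).1 (hnz m hm).2 (hnz n hn).1 (hnz n hn).2 j1 j2 j1 j2
                      rwa [if_neg (fun h => hmn.ne' (Fin.ext h.1)), sub_eq_zero] at this
                  have a := (cross3 i hi j hj (Ne.symm hji) n n).2.2.1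
                  have b := (cross3 i hi j hj (Ne.symm hji) n m).2.2.2
                  have ab := a.mul_right b
                  simp only [E]
                  rw [mul_assoc (q m i), hpqj, mul_assoc (q m i) (q n j * p m j), ← ab.eq, mul_assoc (q m i) (p n i)]
                · rfl
        · congr 1
          rw [Finset.sum_range]
          refine Finset.sum_congr rfl fun m _ => ?_
          rw [Finset.sum_range]
          exact Finset.sum_congr rfl fun n _ => hF i hi m n
      · refine Finset.sum_congr rfl fun j hj => ?_
        congr 1
        rw [Finset.sum_range]
        refine Finset.sum_congr rfl fun m _ => ?_
        rw [Finset.sum_range]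
        refine Finset.sum_congr rfl fun n _ => ?_
        simp only [E, mul_assoc]
  intro i j i1 i2 j1 j2
  by_cases hij : i = j
  · rw [hij]
  have hi : i ∈ s := Finset.mem_Icc.2 ⟨i1, i2⟩
  have hj : j ∈ s := Finset.mem_Icc.2 ⟨j1, j2⟩
  obtain ⟨W, Wc, hWi⟩ := hW i hi
  obtain ⟨W', Wc', hWj⟩ := hW j hj
  have main := S.main (z := z) (o := o) hcc hi hj hij
    (fun i hi j hj hij => hz_distinct i j (hs i hi).1 (hs i hi).2 (hs j hj).1 (hs j hj).2 hij)
    (fun i hi => hz1 i (hs i hi).1 (hs i hi).2)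
  have main2 : Commute (z i • H i) (z j • H j) := by
    rw [hWi, hWj]
    exact (main.add_right (Wc' _).symm).add_left (Wc _)
  have := (main2.smul_left (z i)⁻¹).smul_right (z j)⁻¹
  rw [inv_smul_smul₀ (hz0 i i1 i2), inv_smul_smul₀ (hz0 j j1 j2)] at this
  exact this
end

section
/- For every κ ∈ ℂ, the time-dependent Schrödinger system is completely integrable in the sense of Frobenius: for all 1 ≤ i, j ≤ N, the ℂ-linear operators κ∂_{z_i} − H_i and κ∂_{z_j} − H_j on K[q] commute, i.e. (κ∂_{z_i} − H_i)(κ∂_{z_j} − H_j) = (κ∂_{z_j} − H_j)(κ∂_{z_i} − H_i). -/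
/-!
Statement 5: complete integrability (in the Frobenius sense) of the
time-dependent Schrödinger system.  The coefficient field `K` is a field of
rational functions in `z 1, …, z N`, presented axiomatically as a field
equipped with commuting derivations `D i = ∂/∂z_i`.  The operator `Dz i` is
the `ℂ`-linear derivation of `K[q] = MvPolynomial (Fin (L-1) × Fin N) K`
acting as `D i` on coefficients and annihilating the variables.
-/

noncomputable section

/-- Multiplication by the constant `k : K`, as a `ℂ`-linear endomorphism of
`K[q]`. -/
def scmul (L N : ℕ) (K : Type*) [Field K] [Algebra ℂ K] (k : K) :
    Module.End ℂ (MvPolynomial (Fin (L - 1) × Fin N) K) :=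
  LinearMap.mulLeft ℂ (MvPolynomial.C k)

set_option linter.unusedSectionVars false
set_option linter.unusedSimpArgs false

theorem comm_sum_aux {A α β : Type*} [Ring A] [Fintype α] [Fintype β] (f : α → A) (g : β → A) :
    (∑ x, f x) * (∑ y, g y) - (∑ y, g y) * (∑ x, f x) = ∑ x, ∑ y, (f x * g y - g y * f x) := by
  simp only [Finset.sum_sub_distrib]
  rw [Finset.sum_mul_sum, Finset.sum_mul_sum, Finset.sum_comm (γ := α) (f := fun x y => g y * f x)]

/-- The general form of the classical Yang-Baxter relation. -/
theorem cybe_aux {K A ι : Type*} [Field K] [Ring A] [Algebra K A] [Fintype ι] [DecidableEq ι]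
    (E F W : ι → ι → A) (c d g : ι → ι → K) (q : K)
    (hE : ∀ a b x y, E a b * E x y - E x y * E a b
      = (if b = x then E a y else 0) - (if y = a then E x b else 0))
    (hF : ∀ a b x y, F a b * F x y - F x y * F a b
      = (if b = x then F a y else 0) - (if y = a then F x b else 0))
    (hEF : ∀ a b x y, E a b * F x y = F x y * E a b)
    (hWC : ∀ m n a b, W m n * (E a b * F b a) = (E a b * F b a) * W m n)
    (hW : ∀ m n a b, E m n * W m n * (F a b * W a b) - F a b * W a b * (E m n * W m n)
      = E m n * F a b * ((if m = b then W a n else 0) - (if a = n then W m b else 0)))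
    (h1 : ∀ m n p, c p n * d m p = -(c m n * g p m) + d m n * g p n
      + (if m = n ∧ p = n then q else 0))
    (h2 : ∀ m n p, c m p * d p n = -(c m n * g n p) + d m n * g m p
      + (if m = n ∧ p = n then q else 0)) :
    (∑ x : ι × ι, c x.1 x.2 • (E x.1 x.2 * W x.1 x.2)) *
        (∑ x : ι × ι, d x.1 x.2 • (F x.1 x.2 * W x.1 x.2))
      - (∑ x : ι × ι, d x.1 x.2 • (F x.1 x.2 * W x.1 x.2)) *
        (∑ x : ι × ι, c x.1 x.2 • (E x.1 x.2 * W x.1 x.2))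
    = ((∑ x : ι × ι, c x.1 x.2 • (E x.1 x.2 * W x.1 x.2)) *
        (∑ x : ι × ι, g x.1 x.2 • (E x.1 x.2 * F x.2 x.1))
      - (∑ x : ι × ι, g x.1 x.2 • (E x.1 x.2 * F x.2 x.1)) *
        (∑ x : ι × ι, c x.1 x.2 • (E x.1 x.2 * W x.1 x.2)))
    + ((∑ x : ι × ι, d x.1 x.2 • (F x.1 x.2 * W x.1 x.2)) *
        (∑ x : ι × ι, g x.1 x.2 • (E x.1 x.2 * F x.2 x.1))
      - (∑ x : ι × ι, g x.1 x.2 • (E x.1 x.2 * F x.2 x.1)) *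
        (∑ x : ι × ι, d x.1 x.2 • (F x.1 x.2 * W x.1 x.2))) := by
  have AB : (∑ x : ι × ι, c x.1 x.2 • (E x.1 x.2 * W x.1 x.2)) *
        (∑ x : ι × ι, d x.1 x.2 • (F x.1 x.2 * W x.1 x.2))
      - (∑ x : ι × ι, d x.1 x.2 • (F x.1 x.2 * W x.1 x.2)) *
        (∑ x : ι × ι, c x.1 x.2 • (E x.1 x.2 * W x.1 x.2))
      = (∑ m, ∑ n, ∑ p, (c p n * d m p) • (E p n * F m p * W m n))
        - ∑ m, ∑ n, ∑ p, (c m p * d p n) • (E m p * F p n * W m n) := by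
    rw [comm_sum_aux]
    have : ∀ x y : ι × ι, c x.1 x.2 • (E x.1 x.2 * W x.1 x.2) * d y.1 y.2 • (F y.1 y.2 * W y.1 y.2)
        - d y.1 y.2 • (F y.1 y.2 * W y.1 y.2) * c x.1 x.2 • (E x.1 x.2 * W x.1 x.2)
        = (if x.1 = y.2 then (c x.1 x.2 * d y.1 y.2) • (E x.1 x.2 * F y.1 y.2 * W y.1 x.2) else 0)
         - (if y.1 = x.2 then (c x.1 x.2 * d y.1 y.2) • (E x.1 x.2 * F y.1 y.2 * W x.1 y.2) else 0) := by
      intro x y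
      rw [smul_mul_smul_comm, smul_mul_smul_comm, mul_comm (d _ _), ← smul_sub, hW]
      split_ifs <;> simp [mul_sub, smul_sub]
    simp only [this, Fintype.sum_prod_type, Finset.sum_sub_distrib, Finset.sum_ite_eq,
      Finset.sum_ite_eq', Finset.mem_univ, if_true]
    congr 1
    · rw [Finset.sum_comm]
      rw [Finset.sum_congr rfl (fun _ _ => Finset.sum_comm)]
      rw [Finset.sum_comm]
    · apply Finset.sum_congr rfl; intro m _
      conv_lhs => enter [2, n]; rw [Finset.sum_comm]
      simp only [Finset.sum_ite_eq, Finset.sum_ite_eq', Finset.mem_univ, if_true]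
      rw [Finset.sum_comm]
  have AC : (∑ x : ι × ι, c x.1 x.2 • (E x.1 x.2 * W x.1 x.2)) *
        (∑ x : ι × ι, g x.1 x.2 • (E x.1 x.2 * F x.2 x.1))
      - (∑ x : ι × ι, g x.1 x.2 • (E x.1 x.2 * F x.2 x.1)) *
        (∑ x : ι × ι, c x.1 x.2 • (E x.1 x.2 * W x.1 x.2))
      = (∑ m, ∑ n, ∑ p, (c m n * g n p) • (E m p * F p n * W m n))
        - ∑ m, ∑ n, ∑ p, (c m n * g p m) • (E p n * F m p * W m n) := by
    rw [comm_sum_aux]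
    have : ∀ x y : ι × ι, c x.1 x.2 • (E x.1 x.2 * W x.1 x.2) * g y.1 y.2 • (E y.1 y.2 * F y.2 y.1)
        - g y.1 y.2 • (E y.1 y.2 * F y.2 y.1) * c x.1 x.2 • (E x.1 x.2 * W x.1 x.2)
        = (if x.2 = y.1 then (c x.1 x.2 * g y.1 y.2) • (E x.1 y.2 * F y.2 y.1 * W x.1 x.2) else 0)
         - (if y.2 = x.1 then (c x.1 x.2 * g y.1 y.2) • (E y.1 x.2 * F y.2 y.1 * W x.1 x.2) else 0) := by
      intro x y
      have key : E x.1 x.2 * W x.1 x.2 * (E y.1 y.2 * F y.2 y.1)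
          - E y.1 y.2 * F y.2 y.1 * (E x.1 x.2 * W x.1 x.2)
          = (E x.1 x.2 * E y.1 y.2 - E y.1 y.2 * E x.1 x.2) * F y.2 y.1 * W x.1 x.2 := by
        rw [mul_assoc (E x.1 x.2), hWC, mul_assoc (E y.1 y.2) (F _ _) (E x.1 x.2 * W x.1 x.2),
          ← mul_assoc (F y.2 y.1) (E _ _), ← hEF]
        noncomm_ring
      rw [smul_mul_smul_comm, smul_mul_smul_comm, mul_comm (g _ _), ← smul_sub, key, hE]
      split_ifs <;> simp [sub_mul, smul_sub]
    simp only [this, Fintype.sum_prod_type, Finset.sum_sub_distrib, Finset.sum_ite_eq,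
      Finset.sum_ite_eq', Finset.mem_univ, if_true]
    congr 1
    · apply Finset.sum_congr rfl; intro m _
      apply Finset.sum_congr rfl; intro n _
      rw [Finset.sum_comm]
      apply Finset.sum_congr rfl; intro p _
      simp
  have BC : (∑ x : ι × ι, d x.1 x.2 • (F x.1 x.2 * W x.1 x.2)) *
        (∑ x : ι × ι, g x.1 x.2 • (E x.1 x.2 * F x.2 x.1))
      - (∑ x : ι × ι, g x.1 x.2 • (E x.1 x.2 * F x.2 x.1)) *
        (∑ x : ι × ι, d x.1 x.2 • (F x.1 x.2 * W x.1 x.2))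
      = (∑ m, ∑ n, ∑ p, (d m n * g p n) • (E p n * F m p * W m n))
        - ∑ m, ∑ n, ∑ p, (d m n * g m p) • (E m p * F p n * W m n) := by
    rw [comm_sum_aux]
    have : ∀ x y : ι × ι, d x.1 x.2 • (F x.1 x.2 * W x.1 x.2) * g y.1 y.2 • (E y.1 y.2 * F y.2 y.1)
        - g y.1 y.2 • (E y.1 y.2 * F y.2 y.1) * d x.1 x.2 • (F x.1 x.2 * W x.1 x.2)
        = (if x.2 = y.2 then (d x.1 x.2 * g y.1 y.2) • (E y.1 y.2 * F x.1 y.1 * W x.1 x.2) else 0)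
         - (if y.1 = x.1 then (d x.1 x.2 * g y.1 y.2) • (E y.1 y.2 * F y.2 x.2 * W x.1 x.2) else 0) := by
      intro x y
      have key : F x.1 x.2 * W x.1 x.2 * (E y.1 y.2 * F y.2 y.1)
          - E y.1 y.2 * F y.2 y.1 * (F x.1 x.2 * W x.1 x.2)
          = E y.1 y.2 * (F x.1 x.2 * F y.2 y.1 - F y.2 y.1 * F x.1 x.2) * W x.1 x.2 := by
        rw [mul_assoc (F x.1 x.2), hWC, ← mul_assoc (F x.1 x.2), ← mul_assoc (F x.1 x.2), ← hEF]
        noncomm_ring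
      rw [smul_mul_smul_comm, smul_mul_smul_comm, mul_comm (g _ _), ← smul_sub, key, hF]
      split_ifs <;> simp [mul_sub, sub_mul, smul_sub]
    simp only [this, Fintype.sum_prod_type, Finset.sum_sub_distrib, Finset.sum_ite_eq,
      Finset.sum_ite_eq', Finset.mem_univ, if_true]
    congr 1
    · apply Finset.sum_congr rfl; intro m _
      apply Finset.sum_congr rfl; intro n _
      rw [Finset.sum_comm]
      simp
  rw [AB, AC, BC]
  simp only [h1, h2, ← Finset.sum_sub_distrib, ← Finset.sum_add_distrib]
  apply Finset.sum_congr rfl; intro m _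
  apply Finset.sum_congr rfl; intro n _
  apply Finset.sum_congr rfl; intro p _
  by_cases h : m = n ∧ p = n
  · obtain ⟨rfl, rfl⟩ := h
    simp only [add_smul, neg_smul]
    abel
  · simp only [h, if_false, add_smul, neg_smul, zero_smul]
    abel

theorem comm_of_aux {A : Type*} [Ring A] {T : Type*} [DecidableEq T] (s : Finset T) (Di Dj r : A) (Ri Rj : T → A)
    (h1 : Di * Dj = Dj * Di)
    (h2 : ∀ o ∈ s, Di * Rj o = Rj o * Di) (h3 : ∀ o ∈ s, Dj * Ri o = Ri o * Dj)
    (h4 : (Di + Dj) * r = r * (Di + Dj))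
    (h5 : ∀ o ∈ s, Ri o * Rj o - Rj o * Ri o
      = (Ri o * r - r * Ri o) + (Rj o * r - r * Rj o))
    (h6 : ∀ o ∈ s, ∀ o' ∈ s, o ≠ o' → Ri o * Rj o' = Rj o' * Ri o) :
    (Di + r + ∑ o ∈ s, Ri o) * (Dj - r + ∑ o ∈ s, Rj o)
      = (Dj - r + ∑ o ∈ s, Rj o) * (Di + r + ∑ o ∈ s, Ri o) := by
  have k2 : Di * (∑ o ∈ s, Rj o) = (∑ o ∈ s, Rj o) * Di := by
    rw [Finset.mul_sum, Finset.sum_mul]; exact Finset.sum_congr rfl h2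
  have k3 : Dj * (∑ o ∈ s, Ri o) = (∑ o ∈ s, Ri o) * Dj := by
    rw [Finset.mul_sum, Finset.sum_mul]; exact Finset.sum_congr rfl h3
  have k5 : (∑ o ∈ s, Ri o) * (∑ o ∈ s, Rj o) - (∑ o ∈ s, Rj o) * (∑ o ∈ s, Ri o)
      = ((∑ o ∈ s, Ri o) * r - r * (∑ o ∈ s, Ri o)) + ((∑ o ∈ s, Rj o) * r - r * (∑ o ∈ s, Rj o)) := by
    rw [Finset.sum_mul_sum, Finset.sum_mul_sum, Finset.sum_comm (f := fun x y => Rj x * Ri y)]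
    simp only [Finset.mul_sum, Finset.sum_mul, ← Finset.sum_sub_distrib, ← Finset.sum_add_distrib]
    apply Finset.sum_congr rfl
    intro o ho
    rw [← h5 o ho, Finset.sum_eq_single o]
    · intro o' ho' hne
      rw [h6 o ho o' ho' hne.symm, sub_self]
    · intro h; exact absurd ho h
  generalize (∑ o ∈ s, Ri o) = X at *
  generalize (∑ o ∈ s, Rj o) = Y at *
  rw [← sub_eq_zero]
  have : (Di + r + X) * (Dj - r + Y) - (Dj - r + Y) * (Di + r + X)
     = (Di * Dj - Dj * Di) - ((Di + Dj) * r - r * (Di + Dj)) + (Di * Y - Y * Di) - (Dj * X - X * Dj)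
      + ((X * Y - Y * X) - ((X * r - r * X) + (Y * r - r * Y))) := by noncomm_ring
  rw [this, h1, h4, k2, k3, k5]; simp

/-- step coefficient -/
def stp {ι : Type*} [LinearOrder ι] (K : Type*) [Field K] (m n : ι) : K :=
  if m < n then 1 else if m = n then 1 / 2 else 0

theorem stp_id1 {K ι : Type*} [Field K] [CharZero K] [LinearOrder ι] (u v w : K) (h : u + u * v = w * (v - u)) (m n p : ι) :
    (stp K p n + u) * (stp K m p + v) = -((stp K m n + u) * (stp K p m + w)) + (stp K m n + v) * (stp K p n + w)
      + (if m = n ∧ p = n then 1/4 else 0) := by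
  rcases lt_trichotomy m n with h1 | h1 | h1 <;> rcases lt_trichotomy p n with h2 | h2 | h2 <;>
  rcases lt_trichotomy m p with h3 | h3 | h3 <;>
  first
  | (exfalso; order)
  | (simp only [stp, h1, h2, h3, h1.ne, h2.ne, h3.ne, h1.ne', h2.ne', h3.ne', h1.not_gt, h2.not_gt, h3.not_gt, if_true, if_false, and_false, false_and, and_self, lt_irrefl]
     linear_combination h)
  | (subst_vars
     simp_all [stp, not_lt_of_gt, ne_of_gt, ne_of_lt]
     try linear_combination h)

theorem stp_id2 {K ι : Type*} [Field K] [CharZero K] [LinearOrder ι] (u v w : K) (h : u + u * v = w * (v - u)) (m n p : ι) :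
    (stp K m p + u) * (stp K p n + v) = -((stp K m n + u) * (stp K n p + w)) + (stp K m n + v) * (stp K m p + w)
      + (if m = n ∧ p = n then 1/4 else 0) := by
  rcases lt_trichotomy m n with h1 | h1 | h1 <;> rcases lt_trichotomy p n with h2 | h2 | h2 <;>
  rcases lt_trichotomy m p with h3 | h3 | h3 <;>
  first
  | (exfalso; order)
  | (simp only [stp, h1, h2, h3, h1.ne, h2.ne, h3.ne, h1.ne', h2.ne', h3.ne', h1.not_gt, h2.not_gt, h3.not_gt, if_true, if_false, and_false, false_and, and_self, lt_irrefl]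
     linear_combination h)
  | (subst_vars
     simp_all [stp, not_lt_of_gt, ne_of_gt, ne_of_lt]
     try linear_combination h)

theorem stp_add {K ι : Type*} [Field K] [CharZero K] [LinearOrder ι] (m n : ι) :
    stp K m n + stp K n m = 1 := by
  rcases lt_trichotomy m n with h1 | h1 | h1
  · simp [stp, h1, h1.not_gt, h1.ne']
  · subst h1; simp [stp]; norm_num
  · simp [stp, h1, h1.not_gt, h1.ne']

theorem gaudin_aux {K A ι S : Type*} [Field K] [CharZero K] [Ring A] [Algebra K A] [Fintype ι] [LinearOrder ι]
    [Fintype S] [DecidableEq S]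
    (E : S → ι → ι → A) (W : ι → ι → A) (z : S → K) (dd : ι → K)
    (hE : ∀ i a b x y, E i a b * E i x y - E i x y * E i a b
      = (if b = x then E i a y else 0) - (if y = a then E i x b else 0))
    (hEE : ∀ i j, i ≠ j → ∀ a b x y, E i a b * E j x y = E j x y * E i a b)
    (hWC : ∀ i j, i ≠ j → ∀ m n a b, W m n * (E i a b * E j b a) = (E i a b * E j b a) * W m n)
    (hWD : ∀ i m n a, W m n * E i a a = E i a a * W m n)
    (hW : ∀ i j, i ≠ j → ∀ m n a b,
      E i m n * W m n * (E j a b * W a b) - E j a b * W a b * (E i m n * W m n)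
      = E i m n * E j a b * ((if m = b then W a n else 0) - (if a = n then W m b else 0)))
    (hz : ∀ i j, i ≠ j → z i ≠ z j) (hz1 : ∀ i, z i ≠ 1) (Z : S → A) (k : S → K)
    (hZ : ∀ i, Z i = (∑ n, dd n • E i n n)
      + (∑ j ∈ Finset.univ.erase i,
          ∑ x : ι × ι, (stp K x.1 x.2 + z j / (z i - z j)) • (E i x.1 x.2 * E j x.2 x.1))
      + (∑ x : ι × ι, (stp K x.1 x.2 + 1 / (z i - 1)) • (E i x.1 x.2 * W x.1 x.2))
      + k i • 1) (i j : S) : Z i * Z j = Z j * Z i := by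
  by_cases hij : i = j
  · rw [hij]
  set D : S → A := fun i => ∑ n, dd n • E i n n with hD
  set R : S → Option S → A := fun i o => match o with
    | none => ∑ x : ι × ι, (stp K x.1 x.2 + 1 / (z i - 1)) • (E i x.1 x.2 * W x.1 x.2)
    | some j => ∑ x : ι × ι, (stp K x.1 x.2 + z j / (z i - z j)) • (E i x.1 x.2 * E j x.2 x.1) with hR
  have hanti : ∀ i j, i ≠ j → R j (some i) = - R i (some j) := by
    intro i j hij
    simp only [hR]
    rw [Fintype.sum_prod_type, Finset.sum_comm, Fintype.sum_prod_type, ← Finset.sum_neg_distrib]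
    apply Finset.sum_congr rfl; intro m _
    rw [← Finset.sum_neg_distrib]
    apply Finset.sum_congr rfl; intro n _
    simp only
    rw [hEE i j hij, ← neg_smul]
    congr 1
    have h1 := stp_add (K := K) m n
    have h2 : z i - z j ≠ 0 := sub_ne_zero.2 (hz i j hij)
    have h3 : z j - z i ≠ 0 := sub_ne_zero.2 (hz j i (Ne.symm hij))
    have h4 : z i / (z j - z i) = - 1 - z j / (z i - z j) := by
      field_simp
      ring
    rw [h4]
    linear_combination h1
  set s : Finset (Option S) := (Finset.univ.erase (some i)).erase (some j) with hs
  have hs' : (Finset.univ.erase (some j)).erase (some i) = s := by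
    rw [hs, Finset.erase_right_comm]
  have hform : ∀ i, Z i = D i + (∑ o ∈ Finset.univ.erase (some i), R i o) + k i • 1 := by
    intro i
    rw [hZ]
    congr 1
    rw [add_assoc]
    congr 1
    have : (Finset.univ.erase (some i) : Finset (Option S))
        = insert none ((Finset.univ.erase i).map Function.Embedding.some) := by
      ext o; cases o <;> simp
    rw [this, Finset.sum_insert (by simp), Finset.sum_map, add_comm]
    rfl
  have hi : Z i = (D i + R i (some j) + ∑ o ∈ s, R i o) + k i • 1 := by
    rw [hform, ← Finset.add_sum_erase (Finset.univ.erase (some i)) (R i) (a := some j)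
      (by simp [Ne.symm hij]), ← hs]
    abel
  have hj : Z j = (D j - R i (some j) + ∑ o ∈ s, R j o) + k j • 1 := by
    rw [hform, ← Finset.add_sum_erase (Finset.univ.erase (some j)) (R j) (a := some i)
      (by simp [hij]), hs', hanti i j hij, sub_eq_add_neg]
    abel
  have main : (D i + R i (some j) + ∑ o ∈ s, R i o) * (D j - R i (some j) + ∑ o ∈ s, R j o)
      = (D j - R i (some j) + ∑ o ∈ s, R j o) * (D i + R i (some j) + ∑ o ∈ s, R i o) := by
    have hDR : ∀ i j, i ≠ j → ∀ o, o ≠ some i → Commute (D i) (R j o) := by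
      intro i j hij o ho
      cases o with
      | none =>
        simp only [hR, hD]
        refine Commute.sum_left _ _ _ fun n _ => Commute.sum_right _ _ _ fun x _ => ?_
        refine Commute.smul_left (Commute.smul_right ?_ _) _
        refine Commute.mul_right (hEE i j hij _ _ _ _) (hWD i _ _ _).symm
      | some k =>
        have hk : i ≠ k := fun h => ho (by rw [h])
        simp only [hR, hD]
        refine Commute.sum_left _ _ _ fun n _ => Commute.sum_right _ _ _ fun x _ => ?_
        refine Commute.smul_left (Commute.smul_right ?_ _) _
        exact Commute.mul_right (hEE i j hij _ _ _ _) (hEE i k hk _ _ _ _)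
    apply comm_of_aux
    · show Commute (D i) (D j)
      simp only [hD]
      refine Commute.sum_left _ _ _ fun n _ => Commute.sum_right _ _ _ fun x _ => ?_
      exact Commute.smul_left (Commute.smul_right (hEE i j hij _ _ _ _) _) _
    · intro o ho
      exact hDR i j hij o (by simp [hs] at ho; exact ho.2)
    · intro o ho
      exact hDR j i (Ne.symm hij) o (by simp [hs] at ho; exact ho.1)
    · show Commute (D i + D j) (R i (some j))
      simp only [hR, hD, ← Finset.sum_add_distrib, ← smul_add]
      refine Commute.sum_left _ _ _ fun n _ => Commute.sum_right _ _ _ fun x _ => ?_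
      refine Commute.smul_left (Commute.smul_right ?_ _) _
      show _ = _
      rw [← sub_eq_zero]
      have e1 := hE i n n x.1 x.2
      have e2 := hE j n n x.2 x.1
      have c1 := hEE i j hij x.1 x.2 n n
      have c2 := hEE i j hij n n x.2 x.1
      have : (E i n n + E j n n) * (E i x.1 x.2 * E j x.2 x.1) - E i x.1 x.2 * E j x.2 x.1 * (E i n n + E j n n)
        = (E i n n * E i x.1 x.2 - E i x.1 x.2 * E i n n) * E j x.2 x.1
         + E i x.1 x.2 * (E j n n * E j x.2 x.1 - E j x.2 x.1 * E j n n) := by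
        have t1 : E j n n * (E i x.1 x.2 * E j x.2 x.1) = E i x.1 x.2 * (E j n n * E j x.2 x.1) := by
          rw [← mul_assoc, ← c1, mul_assoc]
        have t2 : E i x.1 x.2 * E j x.2 x.1 * E i n n = E i x.1 x.2 * E i n n * E j x.2 x.1 := by
          rw [mul_assoc, ← c2, ← mul_assoc]
        rw [add_mul, mul_add, t1, t2]
        noncomm_ring
      rw [this, e1, e2]
      by_cases g1 : n = x.1 <;> by_cases g2 : n = x.2
      · simp [← g1, ← g2]
      · simp [← g1, g2, Ne.symm g2]
      · simp [← g2, g1, Ne.symm g1]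
      · simp [g1, g2, Ne.symm g1, Ne.symm g2]
    · intro o ho
      have zij : z i - z j ≠ 0 := sub_ne_zero.2 (hz i j hij)
      cases o with
      | none =>
        have zi : z i - 1 ≠ 0 := sub_ne_zero.2 (hz1 i)
        have zj : z j - 1 ≠ 0 := sub_ne_zero.2 (hz1 j)
        have hid : 1 / (z i - 1) + 1 / (z i - 1) * (1 / (z j - 1))
          = z j / (z i - z j) * (1 / (z j - 1) - 1 / (z i - 1)) := by
          field_simp
          ring
        exact cybe_aux (E i) (E j) W _ _ _ (1/4) (hE i) (hE j) (hEE i j hij) (hWC i j hij) (hW i j hij)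
          (fun m n p => stp_id1 _ _ _ hid m n p) (fun m n p => stp_id2 _ _ _ hid m n p)
      | some k =>
        have hki : i ≠ k := fun h => by simp [hs, h] at ho
        have hkj : j ≠ k := fun h => by simp [hs, h] at ho
        have zi : z i - z k ≠ 0 := sub_ne_zero.2 (hz i k hki)
        have zj : z j - z k ≠ 0 := sub_ne_zero.2 (hz j k hkj)
        have hid : z k / (z i - z k) + z k / (z i - z k) * (z k / (z j - z k))
          = z j / (z i - z j) * (z k / (z j - z k) - z k / (z i - z k)) := by
          field_simp
          ring
        refine cybe_aux (E i) (E j) (fun m n => E k n m) _ _ _ (1/4) (hE i) (hE j) (hEE i j hij) ?_ ?_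
          (fun m n p => stp_id1 _ _ _ hid m n p) (fun m n p => stp_id2 _ _ _ hid m n p)
        · intro m n a b
          exact Commute.mul_right (hEE i k hki _ _ _ _).symm (hEE j k hkj _ _ _ _).symm
        · intro m n a b
          have e1 := hE k n m b a
          have : E i m n * E k n m * (E j a b * E k b a) - E j a b * E k b a * (E i m n * E k n m)
            = E i m n * E j a b * (E k n m * E k b a - E k b a * E k n m) := by
            have t1 : E i m n * E k n m * (E j a b * E k b a) = E i m n * E j a b * (E k n m * E k b a) := by
              rw [mul_assoc, ← mul_assoc (E k n m), ← hEE j k hkj]; simp only [mul_assoc]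
            have t2 : E j a b * E k b a * (E i m n * E k n m) = E i m n * E j a b * (E k b a * E k n m) := by
              rw [mul_assoc, ← mul_assoc (E k b a), ← hEE i k hki, hEE i j hij]; simp only [mul_assoc]
            rw [t1, t2, mul_sub]
          rw [this, e1]
    · intro o ho o' ho' hne
      show Commute _ _
      cases o with
      | none => cases o' with
        | none => exact absurd rfl hne
        | some k =>
          have hki : i ≠ k := fun h => by simp [hs, h] at ho'
          have hkj : j ≠ k := fun h => by simp [hs, h] at ho'
          simp only [hR]
          refine Commute.sum_left _ _ _ fun n _ => Commute.sum_right _ _ _ fun x _ => ?_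
          refine Commute.smul_left (Commute.smul_right ?_ _) _
          refine Commute.mul_left (Commute.mul_right (hEE i j hij _ _ _ _) (hEE i k hki _ _ _ _)) ?_
          exact hWC j k hkj _ _ _ _
      | some k =>
        have hki : i ≠ k := fun h => by simp [hs, h] at ho
        have hkj : j ≠ k := fun h => by simp [hs, h] at ho
        cases o' with
        | none =>
          simp only [hR]
          refine Commute.sum_left _ _ _ fun n _ => Commute.sum_right _ _ _ fun x _ => ?_
          refine Commute.smul_left (Commute.smul_right ?_ _) _
          refine Commute.mul_right (Commute.mul_left (hEE i j hij _ _ _ _) (hEE j k hkj _ _ _ _).symm) ?_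
          exact (hWC i k hki _ _ _ _).symm
        | some k' =>
          have hki' : i ≠ k' := fun h => by simp [hs, h] at ho'
          have hkk : k ≠ k' := fun h => hne (by rw [h])
          simp only [hR]
          refine Commute.sum_left _ _ _ fun n _ => Commute.sum_right _ _ _ fun x _ => ?_
          refine Commute.smul_left (Commute.smul_right ?_ _) _
          exact Commute.mul_right (Commute.mul_left (hEE i j hij _ _ _ _) (hEE j k hkj _ _ _ _).symm)
            (Commute.mul_left (hEE i k' hki' _ _ _ _) (hEE k k' hkk _ _ _ _))
  rw [hi, hj]
  have m' : Commute (D i + R i (some j) + ∑ o ∈ s, R i o) (D j - R i (some j) + ∑ o ∈ s, R j o) := main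
  exact Commute.add_left (Commute.add_right m' ((Commute.one_right _).smul_right _))
    (((Commute.one_left _).smul_left _))

section weyl
variable {K A S : Type*} [Field K] [Ring A] [Algebra K A] [Fintype S] [DecidableEq S] {l : ℕ}

/-- the operators `Q` at a site -/
def Qf (q p : Fin l → S → A) (th : S → K) (i : S) : Fin (l + 1) → A :=
  Fin.cases (th i • 1 + ∑ m, q m i * p m i) (fun m => q m i)

/-- the operators `P` at a site -/
def Pf (p : Fin l → S → A) (i : S) : Fin (l + 1) → A :=
  Fin.cases (-1) (fun m => p m i)

/-- the matrix units at a site -/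
def Ef (q p : Fin l → S → A) (th : S → K) (i : S) (a b : Fin (l + 1)) : A :=
  Qf q p th i a * Pf p i b

/-- the total weights -/
def Xf (q p : Fin l → S → A) (th : S → K) (ka : Fin (l + 1) → K) (a : Fin (l + 1)) : A :=
  ka a • 1 + ∑ i, Ef q p th i a a

/-- the reduced site -/
def Wf (X : Fin (l + 1) → A) (a b : Fin (l + 1)) : A :=
  Fin.cases (motive := fun _ => A) (Fin.cases (motive := fun _ => A) (-X 0 - 1) (fun _ => 1) b)
    (fun m => Fin.cases (motive := fun _ => A) (X m.succ * X 0) (fun _ => - X m.succ) b) a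

theorem Wf_rel (X : Fin (l + 1) → A) (hX : ∀ a b, X a * X b = X b * X a) (m n a b : Fin (l + 1))
    (e f : A) (hef : e * f = f * e)
    (he : ∀ c, X c * e = e * X c + ((if c = m then e else 0) - (if c = n then e else 0)))
    (hf : ∀ c, X c * f = f * X c + ((if c = a then f else 0) - (if c = b then f else 0))) :
    e * Wf X m n * (f * Wf X a b) - f * Wf X a b * (e * Wf X m n)
      = e * f * ((if m = b then Wf X a n else 0) - (if a = n then Wf X m b else 0)) := by
  have hX' : ∀ a b x, X a * (X b * x) = X b * (X a * x) := by
    intro a b x; rw [← mul_assoc, hX, mul_assoc]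
  have hef' : ∀ x, f * (e * x) = e * (f * x) := by
    intro x; rw [← mul_assoc, ← hef, mul_assoc]
  have he' : ∀ c x, X c * (e * x) = e * (X c * x) + ((if c = m then e * x else 0) - (if c = n then e * x else 0)) := by
    intro c x; rw [← mul_assoc, he]; split_ifs <;> noncomm_ring
  have hf' : ∀ c x, X c * (f * x) = f * (X c * x) + ((if c = a then f * x else 0) - (if c = b then f * x else 0)) := by
    intro c x; rw [← mul_assoc, hf]; split_ifs <;> noncomm_ring
  cases m using Fin.cases <;> cases n using Fin.cases <;> cases a using Fin.cases <;> cases b using Fin.cases <;>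
  simp only [Wf, Fin.cases_zero, Fin.cases_succ, mul_assoc, mul_add, add_mul, mul_sub, sub_mul, mul_neg, neg_mul, mul_one, one_mul,
    he, hf, he', hf', hef', ← hef, Fin.succ_inj, Fin.succ_ne_zero, (Fin.succ_ne_zero _).symm, if_true, if_false, ite_mul, mul_ite, zero_mul, mul_zero, hX, sub_zero, zero_sub, add_zero] <;>
  (try split_ifs) <;> (try subst_vars) <;> (try contradiction) <;>
  (try simp only [hX', hX, mul_neg, mul_add, mul_sub, neg_neg, sub_self, add_zero, mul_zero]) <;> (try abel)

theorem Q0_q (q p : Fin l → S → A) (th : S → K)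
    (hqq : ∀ m i n j, q m i * q n j = q n j * q m i)
    (hpq : ∀ m i n j, p m i * q n j = q n j * p m i + (if m = n ∧ i = j then 1 else 0)) (i : S) (m : Fin l) :
    Qf q p th i 0 * q m i = q m i * Qf q p th i 0 + q m i := by
  simp only [Qf, Fin.cases_zero, add_mul, mul_add, Finset.sum_mul, Finset.mul_sum, smul_mul_assoc, one_mul, mul_smul_comm, mul_one]
  rw [add_assoc]
  congr 1
  have : ∀ n, q n i * p n i * q m i = q m i * (q n i * p n i) + if n = m then q m i else 0 := by
    intro n
    rw [mul_assoc, hpq, mul_add, ← mul_assoc, hqq n i m i, mul_assoc]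
    congr 1
    split_ifs <;> simp_all
  simp [this, Finset.sum_add_distrib]

theorem p_Q0 (q p : Fin l → S → A) (th : S → K)
    (hpp : ∀ m i n j, p m i * p n j = p n j * p m i)
    (hpq : ∀ m i n j, p m i * q n j = q n j * p m i + (if m = n ∧ i = j then 1 else 0)) (i : S) (m : Fin l) :
    p m i * Qf q p th i 0 = Qf q p th i 0 * p m i + p m i := by
  simp only [Qf, Fin.cases_zero, add_mul, mul_add, Finset.sum_mul, Finset.mul_sum, smul_mul_assoc, one_mul, mul_smul_comm, mul_one]
  rw [add_assoc]
  congr 1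
  have : ∀ n, p m i * (q n i * p n i) = (q n i * p n i) * p m i + if n = m then p m i else 0 := by
    intro n
    rw [← mul_assoc, hpq, add_mul, mul_assoc, hpp m i n i, mul_assoc]
    congr 1
    split_ifs <;> simp_all
  simp [this, Finset.sum_add_distrib]

theorem Ef_gl (q p : Fin l → S → A) (th : S → K)
    (hqq : ∀ m i n j, q m i * q n j = q n j * q m i)
    (hpp : ∀ m i n j, p m i * p n j = p n j * p m i)
    (hpq : ∀ m i n j, p m i * q n j = q n j * p m i + (if m = n ∧ i = j then 1 else 0)) (i : S)
    (a b x y : Fin (l + 1)) :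
    Ef q p th i a b * Ef q p th i x y - Ef q p th i x y * Ef q p th i a b
      = (if b = x then Ef q p th i a y else 0) - (if y = a then Ef q p th i x b else 0) := by
  have h1 := Q0_q q p th hqq hpq i
  have h2 := p_Q0 q p th hpp hpq i
  have h3 : ∀ m n, p m i * q n i = q n i * p m i + (if m = n then 1 else 0) := by
    intro m n; rw [hpq]; simp
  have hqq0 : ∀ m n, q m i * q n i = q n i * q m i := fun m n => hqq m i n i
  have hpp0 : ∀ m n, p m i * p n i = p n i * p m i := fun m n => hpp m i n i
  have hq : ∀ m, Qf q p th i m.succ = q m i := fun m => by simp [Qf]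
  generalize hQ0 : Qf q p th i 0 = T at h1 h2
  have h1' : ∀ m u, T * (q m i * u) = q m i * (T * u) + q m i * u := by
    intro m u; rw [← mul_assoc, h1]; noncomm_ring
  have h2' : ∀ m u, p m i * (T * u) = T * (p m i * u) + p m i * u := by
    intro m u; rw [← mul_assoc, h2]; noncomm_ring
  have h3' : ∀ m n u, p m i * (q n i * u) = q n i * (p m i * u) + (if m = n then u else 0) := by
    intro m n u; rw [← mul_assoc, h3]; split_ifs <;> noncomm_ring
  have hqq' : ∀ m n u, q m i * (q n i * u) = q n i * (q m i * u) := by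
    intro m n u; rw [← mul_assoc, hqq0, mul_assoc]
  have hpp' : ∀ m n u, p m i * (p n i * u) = p n i * (p m i * u) := by
    intro m n u; rw [← mul_assoc, hpp0, mul_assoc]
  cases a using Fin.cases <;> cases b using Fin.cases <;> cases x using Fin.cases <;> cases y using Fin.cases <;>
  simp only [Ef, hq, hQ0, Pf, Fin.cases_zero, Fin.cases_succ, mul_assoc, mul_add, add_mul, mul_neg, neg_mul, mul_one, one_mul,
    h1, h2, h3, h1', h2', h3', Fin.succ_inj, Fin.succ_ne_zero, (Fin.succ_ne_zero _).symm, if_true, if_false, ite_mul, mul_ite, zero_mul, mul_zero, hqq', hpp', hqq0, hpp0] <;>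
  (try split_ifs) <;> (try subst_vars) <;> (try contradiction) <;>
  (try simp only [hqq', hpp', hqq0, hpp0, mul_neg, mul_add, mul_sub, neg_neg, sub_self, add_zero, mul_zero]) <;> (try abel)


theorem Qf_comm (q p : Fin l → S → A) (th : S → K)
    (hqq : ∀ m i n j, q m i * q n j = q n j * q m i)
    (hpp : ∀ m i n j, p m i * p n j = p n j * p m i)
    (hpq : ∀ m i n j, p m i * q n j = q n j * p m i + (if m = n ∧ i = j then 1 else 0)) (i j : S)
    (hij : i ≠ j) (a b : Fin (l + 1)) :
    Commute (Qf q p th i a) (Qf q p th j b) ∧ Commute (Qf q p th i a) (Pf p j b)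
     ∧ Commute (Pf p i a) (Pf p j b) := by
  have pq : ∀ i j, i ≠ j → ∀ m n, Commute (p m i) (q n j) := by
    intro i j hij m n; show _ = _; rw [hpq]; simp [hij]
  have qq : ∀ i j m n, Commute (q m i) (q n j) := fun i j m n => hqq m i n j
  have pp : ∀ i j m n, Commute (p m i) (p n j) := fun i j m n => hpp m i n j
  have Qq : ∀ i j, i ≠ j → ∀ n, Commute (th i • (1 : A) + ∑ m, q m i * p m i) (q n j) := by
    intro i j hij n
    refine Commute.add_left ((Commute.one_left _).smul_left _) (Commute.sum_left _ _ _ fun m _ => ?_)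
    exact Commute.mul_left (qq _ _ _ _) (pq _ _ hij _ _)
  have Qp : ∀ i j, i ≠ j → ∀ n, Commute (th i • (1 : A) + ∑ m, q m i * p m i) (p n j) := by
    intro i j hij n
    refine Commute.add_left ((Commute.one_left _).smul_left _) (Commute.sum_left _ _ _ fun m _ => ?_)
    exact Commute.mul_left (pq _ _ hij.symm _ _).symm (pp _ _ _ _)
  have one : ∀ x : A, Commute x (-1) := fun x => (Commute.one_right x).neg_right
  refine ⟨?_, ?_, ?_⟩
  · cases a using Fin.cases <;> cases b using Fin.cases <;> simp only [Qf, Fin.cases_zero, Fin.cases_succ]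
    · refine Commute.add_right ((Commute.one_right _).smul_right _) (Commute.sum_right _ _ _ fun m _ => ?_)
      exact Commute.mul_right (Qq _ _ hij _) (Qp _ _ hij _)
    · exact Qq _ _ hij _
    · exact (Qq _ _ hij.symm _).symm
    · exact qq _ _ _ _
  · cases a using Fin.cases <;> cases b using Fin.cases <;> simp only [Qf, Pf, Fin.cases_zero, Fin.cases_succ]
    · exact one _
    · exact Qp _ _ hij _
    · exact one _
    · exact (pq _ _ hij.symm _ _).symm
  · cases a using Fin.cases <;> cases b using Fin.cases <;> simp only [Pf, Fin.cases_zero, Fin.cases_succ]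
    · exact one _
    · exact (one _).symm
    · exact one _
    · exact pp _ _ _ _

theorem Ef_comm (q p : Fin l → S → A) (th : S → K)
    (hqq : ∀ m i n j, q m i * q n j = q n j * q m i)
    (hpp : ∀ m i n j, p m i * p n j = p n j * p m i)
    (hpq : ∀ m i n j, p m i * q n j = q n j * p m i + (if m = n ∧ i = j then 1 else 0)) (i j : S)
    (hij : i ≠ j) (a b x y : Fin (l + 1)) :
    Ef q p th i a b * Ef q p th j x y = Ef q p th j x y * Ef q p th i a b := by
  have h := Qf_comm q p th hqq hpp hpq i j hij
  have h' := Qf_comm q p th hqq hpp hpq j i hij.symm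
  exact Commute.mul_left (Commute.mul_right (h a x).1 (h a y).2.1)
    (Commute.mul_right (h' x b).2.1.symm (h b y).2.2)

theorem Xf_E (q p : Fin l → S → A) (th : S → K) (ka : Fin (l + 1) → K)
    (hqq : ∀ m i n j, q m i * q n j = q n j * q m i)
    (hpp : ∀ m i n j, p m i * p n j = p n j * p m i)
    (hpq : ∀ m i n j, p m i * q n j = q n j * p m i + (if m = n ∧ i = j then 1 else 0)) (i : S)
    (c a b : Fin (l + 1)) :
    Xf q p th ka c * Ef q p th i a b = Ef q p th i a b * Xf q p th ka c
      + ((if c = a then Ef q p th i a b else 0) - (if c = b then Ef q p th i a b else 0)) := by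
  rw [← sub_eq_iff_eq_add']
  simp only [Xf, add_mul, mul_add, Finset.sum_mul, Finset.mul_sum, smul_mul_assoc, one_mul,
    mul_smul_comm, mul_one]
  rw [add_sub_add_left_eq_sub, ← Finset.sum_sub_distrib, Finset.sum_eq_single i]
  · rw [Ef_gl q p th hqq hpp hpq]
    by_cases h1 : c = a
    · subst h1
      by_cases h2 : c = b
      · subst h2; simp
      · simp [h2, Ne.symm h2]
    · by_cases h2 : c = b
      · subst h2; simp [h1]
      · simp [h1, h2, Ne.symm h2]
  · intro j _ hj
    rw [Ef_comm q p th hqq hpp hpq j i hj, sub_self]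
  · simp

theorem Xf_X (q p : Fin l → S → A) (th : S → K) (ka : Fin (l + 1) → K)
    (hqq : ∀ m i n j, q m i * q n j = q n j * q m i)
    (hpp : ∀ m i n j, p m i * p n j = p n j * p m i)
    (hpq : ∀ m i n j, p m i * q n j = q n j * p m i + (if m = n ∧ i = j then 1 else 0))
    (a b : Fin (l + 1)) :
    Xf q p th ka a * Xf q p th ka b = Xf q p th ka b * Xf q p th ka a := by
  show Commute (Xf q p th ka a) (ka b • 1 + ∑ i, Ef q p th i b b)
  refine Commute.add_right ((Commute.one_right _).smul_right _) (Commute.sum_right _ _ _ fun m _ => ?_)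
  show _ = _
  rw [Xf_E q p th ka hqq hpp hpq]
  simp

theorem Wf_commute (X : Fin (l + 1) → A) (y : A) (h : ∀ c, Commute (X c) y) (m n : Fin (l + 1)) :
    Commute (Wf X m n) y := by
  cases m using Fin.cases <;> cases n using Fin.cases <;> simp only [Wf, Fin.cases_zero, Fin.cases_succ]
  · exact (h _).neg_left.sub_left (Commute.one_left _)
  · exact Commute.one_left _
  · exact (h _).mul_left (h _)
  · exact (h _).neg_left

/-- the operators `P^{(0)}` -/
def Pz (X : Fin (l + 1) → A) : Fin (l + 1) → A := Fin.cases (-1) (fun m => X m.succ)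
/-- the operators `Q^{(0)}` -/
def Qz (X : Fin (l + 1) → A) : Fin (l + 1) → A := Fin.cases (X 0) (fun _ => -1)

theorem X_p (q p : Fin l → S → A) (th : S → K) (ka : Fin (l + 1) → K)
    (hpp : ∀ m i n j, p m i * p n j = p n j * p m i)
    (hpq : ∀ m i n j, p m i * q n j = q n j * p m i + (if m = n ∧ i = j then 1 else 0)) (i : S)
    (m n : Fin l) :
    Xf q p th ka m.succ * p n i = p n i * Xf q p th ka m.succ - (if m = n then p n i else 0) := by
  have key : ∀ j, q m j * p m j * p n i = p n i * (q m j * p m j)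
      - (if j = i then (if m = n then p n i else 0) else 0) := by
    intro j
    rw [← mul_assoc (p n i), hpq, add_mul, mul_assoc, mul_assoc, hpp m j n i]
    by_cases h1 : j = i
    · subst h1
      by_cases h2 : m = n
      · subst h2; simp
      · simp [h2, Ne.symm h2]
    · simp [h1, Ne.symm h1]
  simp only [Xf, Ef, Qf, Pf, Fin.cases_succ, add_mul, mul_add, Finset.sum_mul, Finset.mul_sum, smul_mul_assoc, one_mul,
    mul_smul_comm, mul_one, key, Finset.sum_sub_distrib, Finset.sum_ite_eq', Finset.sum_ite_eq, Finset.mem_univ, if_true]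
  abel

theorem V_eq (q p : Fin l → S → A) (th : S → K) (ka : Fin (l + 1) → K)
    (hpp : ∀ m i n j, p m i * p n j = p n j * p m i)
    (hpq : ∀ m i n j, p m i * q n j = q n j * p m i + (if m = n ∧ i = j then 1 else 0)) (i : S)
    (m n : Fin (l + 1)) :
    Qf q p th i m * Pz (Xf q p th ka) m * Qz (Xf q p th ka) n * Pf p i n
      = Ef q p th i m n * Wf (Xf q p th ka) m n + (if m = n then Ef q p th i m n else 0) := by
  have h := X_p q p th ka hpp hpq i
  cases m using Fin.cases <;> cases n using Fin.cases <;>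
    simp only [Ef, Wf, Pz, Qz, Pf, Fin.cases_zero, Fin.cases_succ, Fin.succ_inj, Fin.succ_ne_zero, (Fin.succ_ne_zero _).symm, if_true, if_false]
  · noncomm_ring
  · noncomm_ring
  · noncomm_ring
  · simp only [mul_neg, neg_mul, mul_one, mul_assoc]
    rw [h]
    split_ifs <;> noncomm_ring

theorem stp_sum {ι : Type*} [Fintype ι] [LinearOrder ι] (c : K) (F : ι → ι → A) :
    ∑ x : ι × ι, (stp K x.1 x.2 + c) • F x.1 x.2
      = (∑ n, ∑ m, if m < n then F m n else 0) + (1 / 2 : K) • (∑ m, F m m) + c • ∑ m, ∑ n, F m n := by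
  rw [Fintype.sum_prod_type]
  simp only [add_smul, Finset.sum_add_distrib, Finset.smul_sum]
  congr 1
  rw [Finset.sum_comm (f := fun n m => if m < n then F m n else 0), ← Finset.sum_add_distrib]
  apply Finset.sum_congr rfl; intro m _
  have : ∀ n, stp K m n • F m n = (if m < n then F m n else 0) + (if m = n then (1/2 : K) • F m n else 0) := by
    intro n
    rcases lt_trichotomy m n with h | h | h
    · simp [stp, h, h.ne]
    · subst h; simp [stp]
    · simp [stp, h.not_gt, h.ne']
  simp [this, Finset.sum_add_distrib]

theorem sum_E (q p : Fin l → S → A) (th : S → K) (i : S) :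
    ∑ m, Ef q p th i m m = - (th i • (1 : A)) := by
  rw [Fin.sum_univ_succ]
  simp [Ef, Qf, Pf]

theorem final_aux [CharZero K] (q p : Fin l → S → A) (th : S → K) (ka ee : Fin (l + 1) → K) (z k : S → K)
    (hqq : ∀ m i n j, q m i * q n j = q n j * q m i)
    (hpp : ∀ m i n j, p m i * p n j = p n j * p m i)
    (hpq : ∀ m i n j, p m i * q n j = q n j * p m i + (if m = n ∧ i = j then 1 else 0))
    (hz : ∀ i j, i ≠ j → z i ≠ z j) (hz1 : ∀ i, z i ≠ 1) (Z : S → A)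
    (hZ : ∀ i, Z i = (∑ n, ee n • (Qf q p th i n * Pf p i n))
      + ((∑ n, ∑ m, if m < n then Qf q p th i m * Pz (Xf q p th ka) m * Qz (Xf q p th ka) n * Pf p i n else 0)
        + ∑ j, ∑ n, ∑ m, if m < n then Qf q p th i m * Pf p j m * Qf q p th j n * Pf p i n else 0)
      + (z i - 1)⁻¹ • (∑ m, ∑ n, Qf q p th i m * Pz (Xf q p th ka) m * Qz (Xf q p th ka) n * Pf p i n)
      + (∑ j ∈ Finset.univ.erase i, (z j / (z i - z j)) •
          ∑ m, ∑ n, Qf q p th i m * Pf p i n * Qf q p th j n * Pf p j m)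
      + k i • 1) (i j : S) : Z i * Z j = Z j * Z i := by
  set E := Ef q p th with hEdef
  set X := Xf q p th ka with hXdef
  have hE := Ef_gl q p th hqq hpp hpq
  have hEE := Ef_comm q p th hqq hpp hpq
  have hXE := Xf_E q p th ka hqq hpp hpq
  have hXX := Xf_X q p th ka hqq hpp hpq
  have hXC : ∀ i j m a b, Commute (X m) (E i a b * E j b a) := by
    intro i j m a b
    show _ = _
    rw [← mul_assoc, hXE, add_mul, mul_assoc (E i a b), hXE]
    split_ifs <;> noncomm_ring
  refine gaudin_aux E (Wf X) z
    (fun n => ee n + (ka n + if n = 0 then 1 else 0) / 2) hE hEE ?_ ?_ ?_ hz hz1 Z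
    (fun i => k i - (z i - 1)⁻¹ * th i + th i ^ 2 / 2) ?_ i j
  · intro i j _ m n a b
    exact Wf_commute X _ (fun c => hXC i j c a b) m n
  · intro i m n a
    refine Wf_commute X _ (fun c => ?_) m n
    show _ = _
    have := hXE i c a a
    rw [sub_self, add_zero] at this
    exact this
  · intro i j hij m n a b
    exact Wf_rel X hXX m n a b (E i m n) (E j a b) (hEE i j hij _ _ _ _) (fun c => hXE i c m n)
      (fun c => hXE j c a b)
  · intro i
    rw [hZ i]
    have hV := V_eq q p th ka hpp hpq i
    rw [stp_sum (1 / (z i - 1)) (fun m n => E i m n * Wf X m n)]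
    have hr : ∀ j, ∑ x : Fin (l+1) × Fin (l+1), (stp K x.1 x.2 + z j / (z i - z j)) • (E i x.1 x.2 * E j x.2 x.1)
      = _ := fun j => stp_sum (z j / (z i - z j)) (fun m n => E i m n * E j n m)
    simp only [hr]
    have hO : ∀ j m n, Qf q p th i m * Pf p i n * Qf q p th j n * Pf p j m = E i m n * E j n m := by
      intro j m n; simp only [hEdef, Ef, mul_assoc]
    have hT : ∀ j, i ≠ j → ∀ m n, m < n → Qf q p th i m * Pf p j m * Qf q p th j n * Pf p i n = E i m n * E j n m := by
      intro j hij m n hmn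
      have c1 : Pf p j m * Qf q p th j n = Qf q p th j n * Pf p j m := by
        cases n using Fin.cases with
        | zero => exact absurd hmn (Fin.not_lt_zero m)
        | succ n =>
          cases m using Fin.cases with
          | zero => simp [Pf]
          | succ m =>
            have : m ≠ n := fun h => by simp [h] at hmn
            simp [Pf, Qf, hpq, this]
      have c2 := (Qf_comm q p th hqq hpp hpq i j hij m n).1
      have c3 : Commute (Qf q p th j n * Pf p j m) (Pf p i n) :=
        Commute.mul_left (Qf_comm q p th hqq hpp hpq j i hij.symm n n).2.1
          (Qf_comm q p th hqq hpp hpq j i hij.symm m n).2.2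
      rw [mul_assoc (Qf q p th i m), c1, mul_assoc, c3.eq]
      simp only [hEdef, Ef, mul_assoc]
    have hT0 : ∀ m n, Qf q p th i m * Pf p i m * Qf q p th i n * Pf p i n = E i m m * E i n n := by
      intro m n; simp only [hEdef, Ef, mul_assoc]
    rw [← Finset.add_sum_erase Finset.univ (fun j => ∑ n, ∑ m, if m < n then Qf q p th i m * Pf p j m * Qf q p th j n * Pf p i n else 0) (Finset.mem_univ i)]
    have hT' : ∑ j ∈ Finset.univ.erase i, (∑ n, ∑ m, if m < n then Qf q p th i m * Pf p j m * Qf q p th j n * Pf p i n else 0)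
       = ∑ j ∈ Finset.univ.erase i, (∑ n, ∑ m, if m < n then E i m n * E j n m else 0) := by
      apply Finset.sum_congr rfl; intro j hj
      apply Finset.sum_congr rfl; intro n _
      apply Finset.sum_congr rfl; intro m _
      split_ifs with h
      · exact hT j (Ne.symm (Finset.ne_of_mem_erase hj)) m n h
      · rfl
    rw [hT']
    have hV1 : (∑ n, ∑ m, if m < n then Qf q p th i m * Pz X m * Qz X n * Pf p i n else 0)
        = ∑ n, ∑ m, if m < n then E i m n * Wf X m n else 0 := by
      apply Finset.sum_congr rfl; intro n _
      apply Finset.sum_congr rfl; intro m _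
      split_ifs with h
      · rw [hV, if_neg h.ne, add_zero]
      · rfl
    have hV2 : (∑ m, ∑ n, Qf q p th i m * Pz X m * Qz X n * Pf p i n)
        = (∑ m, ∑ n, E i m n * Wf X m n) - th i • 1 := by
      simp only [hXdef, hV, Finset.sum_add_distrib, Finset.sum_ite_eq, Finset.mem_univ, if_true, sum_E]
      rw [sub_eq_add_neg]
    rw [hV1, hV2]
    simp only [hO, hT0]
    have hsq : (∑ n, ∑ m, if m < n then E i m m * E i n n else 0) + (1 / 2 : K) • (∑ m, E i m m * E i m m)
        = (th i ^ 2 / 2) • (1 : A) := by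
      have s1 := stp_sum (0 : K) (fun m n => E i m m * E i n n)
      simp only [add_zero, zero_smul] at s1
      rw [← s1]
      have s2 : ∑ x : Fin (l+1) × Fin (l+1), stp K x.1 x.2 • (E i x.1 x.1 * E i x.2 x.2)
          = ∑ x : Fin (l+1) × Fin (l+1), stp K x.2 x.1 • (E i x.1 x.1 * E i x.2 x.2) := by
        rw [Fintype.sum_prod_type, Finset.sum_comm, Fintype.sum_prod_type]
        apply Finset.sum_congr rfl; intro m _
        apply Finset.sum_congr rfl; intro n _
        have : E i n n * E i m m = E i m m * E i n n := by
          rw [← sub_eq_zero, hE]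
          by_cases h : n = m
          · subst h; simp
          · simp [h, Ne.symm h]
        rw [this]
      have s3 : (2 : K) • ∑ x : Fin (l+1) × Fin (l+1), stp K x.1 x.2 • (E i x.1 x.1 * E i x.2 x.2)
          = (th i ^ 2) • (1 : A) := by
        rw [two_smul]
        nth_rewrite 2 [s2]
        rw [← Finset.sum_add_distrib]
        simp only [← add_smul, stp_add, one_smul]
        rw [Fintype.sum_prod_type]
        simp only
        rw [← Finset.sum_mul_sum, sum_E]
        simp [sq, smul_smul]
      calc _ = (1 / 2 : K) • ((2 : K) • ∑ x : Fin (l+1) × Fin (l+1), stp K x.1 x.2 • (E i x.1 x.1 * E i x.2 x.2)) := by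
            rw [smul_smul]; norm_num
        _ = _ := by rw [s3, smul_smul]; congr 1; ring
    have hdiag : (∑ m, E i m m * Wf X m m) + ∑ j ∈ Finset.univ.erase i, ∑ m, E i m m * E j m m
        = - (∑ m, (ka m + if m = 0 then 1 else 0) • E i m m) - ∑ m, E i m m * E i m m := by
      rw [Finset.sum_comm, ← Finset.sum_add_distrib, ← Finset.sum_neg_distrib, ← Finset.sum_sub_distrib]
      apply Finset.sum_congr rfl; intro m _
      have hWm : Wf X m m = - X m - (if m = 0 then 1 else 0) := by
        cases m using Fin.cases <;> simp [Wf]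
      have hXm : X m = ka m • 1 + (E i m m + ∑ j ∈ Finset.univ.erase i, E j m m) := by
        rw [Finset.add_sum_erase _ (fun j => E j m m) (Finset.mem_univ i)]; rfl
      rw [hWm, hXm, ← Finset.mul_sum, ← mul_add]
      have : (-(ka m • (1 : A) + (E i m m + ∑ j ∈ Finset.univ.erase i, E j m m)) - if m = 0 then 1 else 0)
         + ∑ j ∈ Finset.univ.erase i, E j m m = -((ka m + if m = 0 then 1 else 0) • (1 : A)) - E i m m := by
        rw [add_smul, ite_smul, one_smul, zero_smul]; abel
      rw [this]
      simp [mul_sub]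
    have hdd : (∑ n, (ee n + (ka n + if n = 0 then 1 else 0) / 2) • E i n n)
        = (∑ n, ee n • E i n n) + (1 / 2 : K) • ∑ m, (ka m + if m = 0 then 1 else 0) • E i m m := by
      rw [Finset.smul_sum, ← Finset.sum_add_distrib]
      apply Finset.sum_congr rfl; intro n _
      rw [add_smul, smul_smul]
      congr 2
      ring
    have hee : (∑ n, ee n • (Qf q p th i n * Pf p i n)) = ∑ n, ee n • E i n n := rfl
    rw [hdd, hee]
    simp only [Finset.sum_add_distrib, ← Finset.smul_sum]
    rw [one_div (z i - 1)]
    generalize (∑ n, ee n • E i n n) = a1 at *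
    generalize (∑ n, ∑ m, if m < n then E i m n * Wf X m n else 0) = a2 at *
    generalize (∑ n, ∑ m, if m < n then E i m m * E i n n else 0) = a3 at *
    generalize (∑ m, ∑ n, E i m n * Wf X m n) = a4 at *
    generalize (∑ m, E i m m * Wf X m m) = a5 at *
    generalize (∑ j ∈ Finset.univ.erase i, ∑ m, E i m m * E j m m) = a6 at *
    generalize (∑ m, (ka m + if m = 0 then 1 else 0) • E i m m) = a7 at *
    generalize (∑ m, E i m m * E i m m) = a8 at *
    rw [← eq_sub_iff_add_eq] at hsq hdiag
    rw [hsq, hdiag]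
    module
end weyl

section concrete
open MvPolynomial

theorem pderiv_mul_X_aux {σ K : Type*} [Field K] [Algebra ℂ K]
    (d : Module.End ℂ (MvPolynomial σ K)) (δ : K → K)
    (hC : ∀ k : K, d (C k) = C (δ k)) (hX : ∀ v, d (X v) = 0)
    (hmul : ∀ f g, d (f * g) = d f * g + f * d g) (v : σ) (f : MvPolynomial σ K) :
    d (pderiv v f) = pderiv v (d f) := by
  classical
  have h1 : d 1 = 0 := by
    have := hmul 1 1
    simpa using this
  have hpX : ∀ w, d (pderiv v (X w)) = 0 := by
    intro w
    rw [pderiv_X]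
    by_cases h : v = w
    · subst h; simp [h1]
    · simp [Ne.symm h]
  induction f using MvPolynomial.induction_on with
  | C a => simp [hC]
  | add f g hf hg => simp [hf, hg]
  | mul_X f w hf =>
    rw [Derivation.leibniz, map_add, hmul, smul_eq_mul, smul_eq_mul, hmul, hmul, hpX, hX, hf, map_add,
      Derivation.leibniz, mul_zero, map_zero]
    simp only [smul_eq_mul]
    ring

theorem derComm_aux {σ K : Type*} [Field K] [Algebra ℂ K]
    (d d' : Module.End ℂ (MvPolynomial σ K)) (δ δ' : K → K)
    (hC : ∀ k : K, d (C k) = C (δ k)) (hX : ∀ v, d (X v) = 0)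
    (hmul : ∀ f g, d (f * g) = d f * g + f * d g)
    (hC' : ∀ k : K, d' (C k) = C (δ' k)) (hX' : ∀ v, d' (X v) = 0)
    (hmul' : ∀ f g, d' (f * g) = d' f * g + f * d' g)
    (hδ : ∀ k, δ (δ' k) = δ' (δ k)) : d * d' = d' * d := by
  refine LinearMap.ext fun f => ?_
  show d (d' f) = d' (d f)
  induction f using MvPolynomial.induction_on with
  | C a => simp [hC, hC', hδ]
  | add f g hf hg => simp [hf, hg]
  | mul_X f w hf =>
    simp only [hmul, hmul', hX, hX', mul_zero, add_zero, hf]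

/-- restriction of scalars for endomorphisms -/
def rho (σ K : Type*) [Field K] [Algebra ℂ K] :
    Module.End K (MvPolynomial σ K) →+* Module.End ℂ (MvPolynomial σ K) where
  toFun f := f.restrictScalars ℂ
  map_one' := rfl
  map_mul' _ _ := rfl
  map_zero' := rfl
  map_add' _ _ := rfl

theorem rho_smul {σ K : Type*} [Field K] [Algebra ℂ K] (c : K) (B : Module.End K (MvPolynomial σ K)) :
    rho σ K (c • B) = LinearMap.mulLeft ℂ (C c) * rho σ K B := by
  refine LinearMap.ext fun f => ?_
  show c • B f = C c * B f
  rw [MvPolynomial.smul_eq_C_mul]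

theorem rho_csmul {σ K : Type*} [Field K] [Algebra ℂ K] (c : ℂ) (B : Module.End K (MvPolynomial σ K)) :
    rho σ K (algebraMap ℂ K c • B) = c • rho σ K B := by
  refine LinearMap.ext fun f => ?_
  show (algebraMap ℂ K c) • B f = c • B f
  rw [algebraMap_smul]

/-- the derivation rule -/
def Der {σ K : Type*} [Field K] [Algebra ℂ K] (d : Module.End ℂ (MvPolynomial σ K))
    (B B' : Module.End K (MvPolynomial σ K)) : Prop :=
  d * rho σ K B = rho σ K B * d + rho σ K B'

section der
variable {σ K : Type*} [Field K] [Algebra ℂ K] {d : Module.End ℂ (MvPolynomial σ K)}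

theorem Der.add {B B' E E' : Module.End K (MvPolynomial σ K)} (h : Der d B B') (h' : Der d E E') :
    Der d (B + E) (B' + E') := by
  unfold Der at *
  rw [map_add, mul_add, h, h', map_add]
  noncomm_ring

theorem Der.sum {ι : Type*} (s : Finset ι) {B B' : ι → Module.End K (MvPolynomial σ K)}
    (h : ∀ i ∈ s, Der d (B i) (B' i)) : Der d (∑ i ∈ s, B i) (∑ i ∈ s, B' i) := by
  classical
  induction s using Finset.induction_on with
  | empty => simp [Der]
  | insert a s ha ih =>
    rw [Finset.sum_insert ha, Finset.sum_insert ha]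
    exact (h a (by simp)).add (ih fun i hi => h i (by simp [hi]))

theorem Der.smul {δ : K → K} (hC : ∀ k : K, d (C k) = C (δ k))
    (hmul : ∀ f g, d (f * g) = d f * g + f * d g)
    {B B' : Module.End K (MvPolynomial σ K)} (h : Der d B B') (c : K) :
    Der d (c • B) (δ c • B + c • B') := by
  unfold Der at *
  rw [map_add, rho_smul, rho_smul, rho_smul]
  have h0 : d * LinearMap.mulLeft ℂ (C c) = LinearMap.mulLeft ℂ (C c) * d + LinearMap.mulLeft ℂ (C (δ c)) := by
    refine LinearMap.ext fun f => ?_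
    show d (C c * f) = C c * d f + C (δ c) * f
    rw [hmul, hC]; ring
  rw [← mul_assoc, h0, add_mul, mul_assoc, h]
  noncomm_ring

theorem Der.mul0 {B E : Module.End K (MvPolynomial σ K)} (h : Der d B 0) (h' : Der d E 0) :
    Der d (B * E) 0 := by
  unfold Der at *
  rw [map_zero, add_zero] at *
  rw [map_mul, ← mul_assoc, h, mul_assoc, h', mul_assoc]

theorem Der.add0 {B E : Module.End K (MvPolynomial σ K)} (h : Der d B 0) (h' : Der d E 0) :
    Der d (B + E) 0 := by
  simpa using h.add h'

theorem Der.sum0 {ι : Type*} (s : Finset ι) {B : ι → Module.End K (MvPolynomial σ K)}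
    (h : ∀ i ∈ s, Der d (B i) 0) : Der d (∑ i ∈ s, B i) 0 := by
  simpa using Der.sum s h

theorem Der.one : Der d 1 0 := by simp [Der]
theorem Der.neg_one : Der d (-1) 0 := by
  unfold Der
  rw [map_zero, add_zero]
  refine LinearMap.ext fun f => ?_
  show d (-f) = -(d f)
  rw [map_neg]
theorem Der.zero : Der d 0 0 := by simp [Der]

theorem Der.csmul {B : Module.End K (MvPolynomial σ K)} (h : Der d B 0) (c : ℂ) :
    Der d (algebraMap ℂ K c • B) 0 := by
  unfold Der at *
  rw [map_zero, add_zero] at *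
  rw [rho_csmul, mul_smul_comm, h, smul_mul_assoc]
end der

/-- the operators `z_i H_i` -/
def Zf {K A S : Type*} [Field K] [Ring A] [Algebra K A] [Fintype S] [DecidableEq S] {l : ℕ}
    (q p : Fin l → S → A) (th : S → K) (ka ee : Fin (l + 1) → K) (z k : S → K) (i : S) : A :=
  (∑ n, ee n • (Qf q p th i n * Pf p i n))
      + ((∑ n, ∑ m, if m < n then Qf q p th i m * Pz (Xf q p th ka) m * Qz (Xf q p th ka) n * Pf p i n else 0)
        + ∑ j, ∑ n, ∑ m, if m < n then Qf q p th i m * Pf p j m * Qf q p th j n * Pf p i n else 0)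
      + (z i - 1)⁻¹ • (∑ m, ∑ n, Qf q p th i m * Pz (Xf q p th ka) m * Qz (Xf q p th ka) n * Pf p i n)
      + (∑ j ∈ Finset.univ.erase i, (z j / (z i - z j)) •
          ∑ m, ∑ n, Qf q p th i m * Pf p i n * Qf q p th j n * Pf p j m)
      + k i • 1

theorem Zf_comm {K A S : Type*} [Field K] [CharZero K] [Ring A] [Algebra K A] [Fintype S] [DecidableEq S] {l : ℕ}
    (q p : Fin l → S → A) (th : S → K) (ka ee : Fin (l + 1) → K) (z k : S → K)
    (hqq : ∀ m i n j, q m i * q n j = q n j * q m i)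
    (hpp : ∀ m i n j, p m i * p n j = p n j * p m i)
    (hpq : ∀ m i n j, p m i * q n j = q n j * p m i + (if m = n ∧ i = j then 1 else 0))
    (hz : ∀ i j, i ≠ j → z i ≠ z j) (hz1 : ∀ i, z i ≠ 1) (i j : S) :
    Zf q p th ka ee z k i * Zf q p th ka ee z k j = Zf q p th ka ee z k j * Zf q p th ka ee z k i :=
  final_aux q p th ka ee z k hqq hpp hpq hz hz1 (Zf q p th ka ee z k) (fun _ => rfl) i j

section derZ
variable {σ K S : Type*} [Field K] [Algebra ℂ K] [Fintype S] [DecidableEq S] {l : ℕ}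
  {d : Module.End ℂ (MvPolynomial σ K)} {δ : Derivation ℂ K K}
  {q p : Fin l → S → Module.End K (MvPolynomial σ K)}
  {th : S → K} {ka ee : Fin (l + 1) → K}

theorem Der.dsmul (hC : ∀ k : K, d (C k) = C (δ k))
    (hmul : ∀ f g, d (f * g) = d f * g + f * d g)
    {B : Module.End K (MvPolynomial σ K)} (h : Der d B 0) {c : K} (hc : δ c = 0) :
    Der d (c • B) 0 := by
  have := h.smul (δ := δ) hC hmul c
  rw [hc, zero_smul, smul_zero, add_zero] at this
  exact this

theorem Der_Qf (hC : ∀ k : K, d (C k) = C (δ k))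
    (hmul : ∀ f g, d (f * g) = d f * g + f * d g)
    (hq : ∀ m j, Der d (q m j) 0) (hp : ∀ m j, Der d (p m j) 0) (hth : ∀ i, δ (th i) = 0) (j : S) (a : Fin (l+1)) :
    Der d (Qf q p th j a) 0 := by
  refine Fin.cases ?_ (fun m => ?_) a
  · exact (Der.one.dsmul hC hmul (hth j)).add0 (Der.sum0 _ fun m _ => (hq _ _).mul0 (hp _ _))
  · exact hq m j

theorem Der_Pf (hp : ∀ m j, Der d (p m j) 0) (j : S) (a : Fin (l+1)) :
    Der d (Pf p j a) 0 := by
  refine Fin.cases ?_ (fun m => ?_) a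
  · exact Der.neg_one
  · exact hp m j

theorem Der_Pz {X : Fin (l + 1) → Module.End K (MvPolynomial σ K)} (hX : ∀ a, Der d (X a) 0) (a : Fin (l+1)) :
    Der d (Pz X a) 0 := by
  refine Fin.cases ?_ (fun m => ?_) a
  · exact Der.neg_one
  · exact hX m.succ

theorem Der_Qz {X : Fin (l + 1) → Module.End K (MvPolynomial σ K)} (hX : ∀ a, Der d (X a) 0) (a : Fin (l+1)) :
    Der d (Qz X a) 0 := by
  refine Fin.cases ?_ (fun m => ?_) a
  · exact hX 0
  · exact Der.neg_one

/-- the Casimir operators -/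
def Om (q p : Fin l → S → Module.End K (MvPolynomial σ K)) (th : S → K) (i j : S) :
    Module.End K (MvPolynomial σ K) :=
  ∑ m, ∑ n, Qf q p th i m * Pf p i n * Qf q p th j n * Pf p j m

theorem Om_symm (hqq : ∀ m i n j, q m i * q n j = q n j * q m i)
    (hpp : ∀ m i n j, p m i * p n j = p n j * p m i)
    (hpq : ∀ m i n j, p m i * q n j = q n j * p m i + (if m = n ∧ i = j then 1 else 0))
    (i j : S) (hij : i ≠ j) : Om q p th i j = Om q p th j i := by
  unfold Om
  rw [Finset.sum_comm]
  apply Finset.sum_congr rfl; intro m _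
  apply Finset.sum_congr rfl; intro n _
  have := Ef_comm q p th hqq hpp hpq i j hij n m m n
  simp only [Ef, ← mul_assoc] at this
  exact this

theorem Der_Zf (hC : ∀ k : K, d (C k) = C (δ k))
    (hmul : ∀ f g, d (f * g) = d f * g + f * d g)
    (hq : ∀ m j, Der d (q m j) 0) (hp : ∀ m j, Der d (p m j) 0)
    (hth : ∀ i, δ (th i) = 0) (hka : ∀ i, δ (ka i) = 0) (hee : ∀ i, δ (ee i) = 0)
    {z k : S → K} {c0 : K} (hc0 : δ c0 = 0)
    (hk : ∀ i, k i = th i * (c0 - ∑ j ∈ Finset.univ.erase i, th j * z j / (z i - z j)))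
    (hz0 : ∀ i, z i ≠ 0) (i j : S) (hij : i ≠ j) (hδ : ∀ a, δ (z a) = if i = a then 1 else 0) :
    Der d ((z j)⁻¹ • Zf q p th ka ee z k j)
      ((1 / (z j - z i) ^ 2) • (Om q p th j i - (th i * th j) • 1)) := by
  have hQf := Der_Qf hC hmul hq hp hth
  have hPf := Der_Pf (d := d) hp
  have hXf : ∀ a, Der d (Xf q p th ka a) 0 := fun a =>
    (Der.one.dsmul hC hmul (hka a)).add0 (Der.sum0 _ fun m _ => (hQf _ _).mul0 (hPf _ _))
  have hPz := Der_Pz hXf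
  have hQz := Der_Qz hXf
  have hOm0 : ∀ a b, Der d (Om q p th a b) 0 := fun a b =>
    Der.sum0 _ fun m _ => Der.sum0 _ fun n _ =>
      (((hQf _ _).mul0 (hPf _ _)).mul0 (hQf _ _)).mul0 (hPf _ _)
  have hdinv : δ ((z j)⁻¹) = 0 := by
    rw [Derivation.leibniz_inv, hδ]; simp [hij]
  have dfrac : ∀ a, a ≠ j → δ (z a / (z j - z a)) = if a = i then z j / (z j - z i) ^ 2 else 0 := by
    intro a ha
    rw [Derivation.leibniz_div, map_sub, hδ, hδ]
    by_cases h : a = i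
    · subst h; simp [hij]; ring
    · simp [hij, Ne.symm h, h]
  have dk : δ (k j) = - (th i * th j) * (z j / (z j - z i) ^ 2) := by
    rw [hk, Derivation.leibniz, hth, map_sub, hc0, map_sum]
    have : ∀ a ∈ Finset.univ.erase j, δ (th a * z a / (z j - z a))
        = if a = i then th i * (z j / (z j - z i) ^ 2) else 0 := by
      intro a ha
      rw [mul_div_assoc, Derivation.leibniz, hth, dfrac a (Finset.ne_of_mem_erase ha)]
      by_cases h : a = i
      · subst h; simp
      · simp [h]
    rw [Finset.sum_congr rfl this, Finset.sum_ite_eq', if_pos (by simp [hij])]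
    simp only [smul_eq_mul]
    ring
  have d1 : Der d (∑ n, ee n • (Qf q p th j n * Pf p j n)) 0 :=
    Der.sum0 _ fun n _ => ((hQf _ _).mul0 (hPf _ _)).dsmul hC hmul (hee n)
  have d2 : Der d ((∑ n, ∑ m, if m < n then Qf q p th j m * Pz (Xf q p th ka) m * Qz (Xf q p th ka) n * Pf p j n else 0)
      + ∑ a, ∑ n, ∑ m, if m < n then Qf q p th j m * Pf p a m * Qf q p th a n * Pf p j n else 0) 0 := by
    refine Der.add0 (Der.sum0 _ fun n _ => Der.sum0 _ fun m _ => ?_)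
      (Der.sum0 _ fun a _ => Der.sum0 _ fun n _ => Der.sum0 _ fun m _ => ?_)
    · split_ifs
      · exact (((hQf _ _).mul0 (hPz _)).mul0 (hQz _)).mul0 (hPf _ _)
      · exact Der.zero
    · split_ifs
      · exact (((hQf _ _).mul0 (hPf _ _)).mul0 (hQf _ _)).mul0 (hPf _ _)
      · exact Der.zero
  have d3 : Der d ((z j - 1)⁻¹ • (∑ m, ∑ n, Qf q p th j m * Pz (Xf q p th ka) m * Qz (Xf q p th ka) n * Pf p j n)) 0 := by
    have h0 : Der d (∑ m, ∑ n, Qf q p th j m * Pz (Xf q p th ka) m * Qz (Xf q p th ka) n * Pf p j n) 0 :=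
      Der.sum0 _ fun m _ => Der.sum0 _ fun n _ => (((hQf _ _).mul0 (hPz _)).mul0 (hQz _)).mul0 (hPf _ _)
    refine h0.dsmul hC hmul ?_
    rw [Derivation.leibniz_inv, map_sub, hδ]; simp [hij]
  have d4 : Der d (∑ a ∈ Finset.univ.erase j, (z a / (z j - z a)) • Om q p th j a)
      ((z j / (z j - z i) ^ 2) • Om q p th j i) := by
    have h0 := Der.sum (d := d) (Finset.univ.erase j) (fun a _ => (hOm0 j a).smul (δ := δ) hC hmul (z a / (z j - z a)))
    have h1 : ∑ a ∈ Finset.univ.erase j, ((δ (z a / (z j - z a))) • Om q p th j a + (z a / (z j - z a)) • (0 : Module.End K (MvPolynomial σ K)))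
        = (z j / (z j - z i) ^ 2) • Om q p th j i := by
      have : ∀ a ∈ Finset.univ.erase j, ((δ (z a / (z j - z a))) • Om q p th j a + (z a / (z j - z a)) • (0 : Module.End K (MvPolynomial σ K)))
         = if a = i then (z j / (z j - z i) ^ 2) • Om q p th j a else 0 := by
        intro a ha
        rw [dfrac a (Finset.ne_of_mem_erase ha), ite_smul, zero_smul, smul_zero, add_zero]
      rw [Finset.sum_congr rfl this, Finset.sum_ite_eq', if_pos (by simp [hij])]
    rw [h1] at h0
    exact h0
  have d5 : Der d (k j • 1) ((- (th i * th j) * (z j / (z j - z i) ^ 2)) • 1) := by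
    have := (Der.one (d := d)).smul (δ := δ) hC hmul (k j)
    rw [dk, smul_zero, add_zero] at this
    exact this
  have h6 := ((((d1.add d2).add d3).add d4).add d5).smul (δ := δ) hC hmul (z j)⁻¹
  rw [hdinv, zero_smul, zero_add] at h6
  have h7 : (z j)⁻¹ • (0 + 0 + 0 + (z j / (z j - z i) ^ 2) • Om q p th j i
      + (- (th i * th j) * (z j / (z j - z i) ^ 2)) • (1 : Module.End K (MvPolynomial σ K)))
      = (1 / (z j - z i) ^ 2) • (Om q p th j i - (th i * th j) • 1) := by
    have h8 : z j / (z j - z i) ^ 2 = z j * (1 / (z j - z i) ^ 2) := by ring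
    have h9 : (z j)⁻¹ * z j = 1 := inv_mul_cancel₀ (hz0 j)
    rw [h8]
    generalize (1 / (z j - z i) ^ 2) = w
    simp only [zero_add, smul_add, smul_sub, smul_smul, ← mul_assoc, h9, one_mul]
    rw [sub_eq_add_neg, ← neg_smul]
    congr 2
    linear_combination (-(th i * th j * w)) * h9
  rw [h7] at h6
  exact h6
end derZ

theorem core_aux {σ K : Type*} [Field K] [Algebra ℂ K] {l N : ℕ}
    (q p : Fin l → Fin N → Module.End K (MvPolynomial σ K))
    (th : Fin N → K) (ka ee : Fin (l + 1) → K) (z k : Fin N → K) (c0 : K)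
    (hk : ∀ i, k i = th i * (c0 - ∑ j ∈ Finset.univ.erase i, th j * z j / (z i - z j)))
    (hqq : ∀ m i n j, q m i * q n j = q n j * q m i)
    (hpp : ∀ m i n j, p m i * p n j = p n j * p m i)
    (hpq : ∀ m i n j, p m i * q n j = q n j * p m i + (if m = n ∧ i = j then 1 else 0))
    (hz : ∀ i j, i ≠ j → z i ≠ z j) (hz0 : ∀ i, z i ≠ 0) (hz1 : ∀ i, z i ≠ 1)
    (D : Fin N → Derivation ℂ K K) (hDz : ∀ i j, D i (z j) = if i = j then 1 else 0)
    (hth : ∀ a i, D a (th i) = 0) (hka : ∀ a i, D a (ka i) = 0) (hee : ∀ a i, D a (ee i) = 0)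
    (hc0 : ∀ a, D a c0 = 0)
    (hDcomm : ∀ i j k, D i (D j k) = D j (D i k))
    (Dq : Fin N → Module.End ℂ (MvPolynomial σ K))
    (hDqC : ∀ i, ∀ k : K, Dq i (C k) = C (D i k))
    (hDqX : ∀ i v, Dq i (X v) = 0)
    (hDqmul : ∀ i f g, Dq i (f * g) = Dq i f * g + f * Dq i g)
    (hDq : ∀ i m j, Der (Dq i) (q m j) 0) (hDp : ∀ i m j, Der (Dq i) (p m j) 0)
    (H : Fin N → Module.End ℂ (MvPolynomial σ K))
    (hH : ∀ i, LinearMap.mulLeft ℂ (C (z i)) * H i = rho σ K (Zf q p th ka ee z k i))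
    (κc : ℂ) (i j : Fin N) :
      (κc • Dq i - H i) * (κc • Dq j - H j)
        = (κc • Dq j - H j) * (κc • Dq i - H i) := by
  by_cases hij : i = j
  · rw [hij]
  have : CharZero K := charZero_of_injective_algebraMap (algebraMap ℂ K).injective
  have hH' : ∀ i, H i = rho σ K ((z i)⁻¹ • Zf q p th ka ee z k i) := by
    intro i
    rw [rho_smul, ← hH, ← mul_assoc]
    have : LinearMap.mulLeft ℂ (C (z i)⁻¹ : MvPolynomial σ K) * LinearMap.mulLeft ℂ (C (z i)) = 1 := by
      refine LinearMap.ext fun f => ?_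
      show C (z i)⁻¹ * (C (z i) * f) = f
      rw [← mul_assoc, ← C_mul, inv_mul_cancel₀ (hz0 i), C_1, one_mul]
    rw [this, one_mul]
  have hHH : H i * H j = H j * H i := by
    have hc := Zf_comm q p th ka ee z k hqq hpp hpq hz hz1 i j
    rw [hH' i, hH' j, ← map_mul, ← map_mul]
    generalize Zf q p th ka ee z k i = a at *
    generalize Zf q p th ka ee z k j = b at *
    rw [smul_mul_smul_comm, smul_mul_smul_comm, hc, mul_comm (z i)⁻¹]
  have hDD : Dq i * Dq j = Dq j * Dq i :=
    derComm_aux _ _ _ _ (hDqC i) (hDqX i) (hDqmul i) (hDqC j) (hDqX j) (hDqmul j) (hDcomm i j)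
  have e1 := Der_Zf (hDqC i) (hDqmul i) (hDq i) (hDp i) (hth i) (hka i) (hee i) (hc0 i) hk hz0 i j hij (hDz i)
  have e2 := Der_Zf (hDqC j) (hDqmul j) (hDq j) (hDp j) (hth j) (hka j) (hee j) (hc0 j) hk hz0 j i
    (Ne.symm hij) (hDz j)
  unfold Der at e1 e2
  rw [← hH'] at e1 e2
  rw [Om_symm hqq hpp hpq j i (Ne.symm hij), mul_comm (th i),
    show (z j - z i) ^ 2 = (z i - z j) ^ 2 by ring] at e1
  rw [← sub_eq_zero]
  have : (κc • Dq i - H i) * (κc • Dq j - H j) - (κc • Dq j - H j) * (κc • Dq i - H i)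
    = (κc * κc) • (Dq i * Dq j - Dq j * Dq i) - κc • ((Dq i * H j - H j * Dq i) - (Dq j * H i - H i * Dq j))
      + (H i * H j - H j * H i) := by
    simp only [sub_mul, mul_sub, smul_mul_assoc, mul_smul_comm, smul_sub, smul_smul]
    abel
  rw [this, hDD, hHH, e1, e2]
  simp
end concrete

theorem icc_aux {M : Type*} [AddCommMonoid M] (n : ℕ) (f : ℕ → M) :
    ∑ j ∈ Finset.Icc 1 n, f j = ∑ j : Fin n, f (j + 1) := by
  rw [← Finset.sum_range (fun j => f (j + 1)), Finset.range_eq_Ico, Finset.sum_Ico_add' f 0 n 1]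
  rfl

theorem icc_erase_aux {M : Type*} [AddCommMonoid M] (n : ℕ) (f : ℕ → M) (i : Fin n) :
    ∑ j ∈ (Finset.Icc 1 n).erase ((i : ℕ) + 1), f j = ∑ j ∈ Finset.univ.erase i, f (j + 1) := by
  symm
  refine Finset.sum_bij (fun j _ => (j : ℕ) + 1) ?_ ?_ ?_ ?_
  · intro a ha
    have h1 := Finset.ne_of_mem_erase ha
    have h2 : (a : ℕ) ≠ i := fun h => h1 (Fin.ext h)
    simp only [Finset.mem_erase, Finset.mem_Icc]
    omega
  · intro a _ b _ h
    exact Fin.ext (by omega)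
  · intro b hb
    simp only [Finset.mem_erase, Finset.mem_Icc] at hb
    refine ⟨⟨b - 1, by omega⟩, ?_, by simp only; omega⟩
    simp only [Finset.mem_erase, Finset.mem_univ, and_true, ne_eq, Fin.ext_iff]
    omega
  · intro a _
    rfl

theorem tri_aux {M : Type*} [AddCommMonoid M] (n : ℕ) (f : ℕ → ℕ → M) :
    ∑ b ∈ Finset.range n, ∑ a ∈ Finset.range b, f a b
      = ∑ b : Fin n, ∑ a : Fin n, if a < b then f a b else 0 := by
  rw [Finset.sum_range]
  apply Finset.sum_congr rfl; intro b _
  rw [← Finset.sum_filter]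
  refine Finset.sum_bij' (fun a h => ⟨a, by have := Finset.mem_range.1 h; omega⟩) (fun a _ => (a : ℕ)) ?_ ?_ ?_ ?_ ?_
  · intro a ha
    have h0 := Finset.mem_range.1 ha
    simp only [Finset.mem_filter, Finset.mem_univ, true_and, Fin.lt_def]
    exact h0
  · intro a ha
    simp only [Finset.mem_filter, Finset.mem_univ, true_and, Fin.lt_def] at ha
    exact Finset.mem_range.2 ha
  · intro a _; rfl
  · intro a _; rfl
  · intro a _; rfl

theorem pderiv_comm_aux {σ K : Type*} [Field K] (a b : σ) (f : MvPolynomial σ K) :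
    MvPolynomial.pderiv a (MvPolynomial.pderiv b f) = MvPolynomial.pderiv b (MvPolynomial.pderiv a f) := by
  classical
  have h : ⁅MvPolynomial.pderiv (R := K) a, MvPolynomial.pderiv (R := K) b⁆ = 0 := by
    refine MvPolynomial.derivation_ext fun i => ?_
    rw [Derivation.commutator_apply, MvPolynomial.pderiv_X, MvPolynomial.pderiv_X]
    have h1 : ∀ c d : σ, MvPolynomial.pderiv (R := K) c (Pi.single (M := fun _ => MvPolynomial σ K) d 1 i) = 0 := by
      intro c d
      by_cases h : i = d
      · subst h; simp
      · simp [h]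
    simp [h1]
  have h2 := congrArg (fun D => D f) h
  simp only [Derivation.commutator_apply] at h2
  exact sub_eq_zero.1 h2

theorem bound_aux {K A B : Type*} [Field K] [Algebra ℂ K] [Ring A] [Algebra K A] [Ring B] [Algebra ℂ B]
    (ρ : A →+* B) (mu : K → B) (hs : ∀ c x, mu c * ρ x = ρ (c • x))
    (hcs : ∀ (c : ℂ) x, ρ (algebraMap ℂ K c • x) = c • ρ x) {l N : ℕ} (q p : Fin l → Fin N → A)
    (e κ θ : ℕ → ℂ) (z : ℕ → K) (Q P : ℕ → ℕ → B)
    (hq : ∀ (m : Fin l) (i : Fin N), Q ((m : ℕ) + 1) ((i : ℕ) + 1) = ρ (q m i))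
    (hp : ∀ (m : Fin l) (i : Fin N), P ((m : ℕ) + 1) ((i : ℕ) + 1) = ρ (p m i))
    (hQ0 : ∀ i, 1 ≤ i → i ≤ N →
      Q 0 i = θ i • (1 : B) + ∑ m ∈ Finset.Icc 1 l, Q m i * P m i)
    (hP0 : ∀ i, 1 ≤ i → i ≤ N → P 0 i = -1)
    (hQm0 : ∀ m, 1 ≤ m → m ≤ l → Q m 0 = -1)
    (hPm0 : ∀ m, 1 ≤ m → m ≤ l →
      P m 0 = κ m • (1 : B) + ∑ i ∈ Finset.Icc 1 N, Q m i * P m i)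
    (hQ00 : Q 0 0 = (κ 0 - ∑ i ∈ Finset.Icc 1 N, θ i) • (1 : B)
      - ∑ i ∈ Finset.Icc 1 N, ∑ m ∈ Finset.Icc 1 l, Q m i * P m i)
    (hP00 : P 0 0 = -1) (th z' k : Fin N → K) (ka ee : Fin (l + 1) → K)
    (hth : ∀ i, th i = algebraMap ℂ K (θ (i + 1)))
    (hka : ∀ a, ka a = algebraMap ℂ K (κ a))
    (hee : ∀ a, ee a = algebraMap ℂ K (e a))
    (hz' : ∀ i, z' i = z (i + 1)) (c0 : K)
    (hk : ∀ i, k i = th i * (c0 - ∑ j ∈ Finset.univ.erase i, th j * z' j / (z' i - z' j)))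
    (i : Fin N) :
    (∑ n ∈ Finset.range (l + 1), e n • (Q n (i + 1) * P n (i + 1)))
      + (∑ j ∈ Finset.range (N + 1), ∑ n ∈ Finset.range (l + 1), ∑ m ∈ Finset.range n,
          Q m (i + 1) * P m j * Q n j * P n (i + 1))
      + mu ((z (i + 1) - 1)⁻¹) * (∑ m ∈ Finset.range (l + 1), ∑ n ∈ Finset.range (l + 1),
          Q m (i + 1) * P m 0 * Q n 0 * P n (i + 1))
      + (∑ j ∈ (Finset.Icc 1 N).erase ((i : ℕ) + 1), mu (z j / (z (i + 1) - z j)) *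
          (∑ m ∈ Finset.range (l + 1), ∑ n ∈ Finset.range (l + 1),
            Q m (i + 1) * P n (i + 1) * Q n j * P m j))
      + mu (algebraMap ℂ K (θ (i + 1)) * (c0
            - ∑ j ∈ (Finset.Icc 1 N).erase ((i : ℕ) + 1),
                algebraMap ℂ K (θ j) * z j / (z (i + 1) - z j)))
      = ρ (Zf q p th ka ee z' k i) := by
  have b1 : ∀ i : Fin N, 1 ≤ (i : ℕ) + 1 := fun i => by omega
  have b2 : ∀ i : Fin N, (i : ℕ) + 1 ≤ N := fun i => by omega
  have qsum : ∀ i : Fin N, ∑ m ∈ Finset.Icc 1 l, Q m (i + 1) * P m (i + 1)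
      = ρ (∑ m, q m i * p m i) := by
    intro i
    rw [icc_aux, map_sum]
    refine Finset.sum_congr rfl fun m _ => ?_
    rw [map_mul, ← hq, ← hp]
  have cs1 : ∀ c : ℂ, ρ (algebraMap ℂ K c • (1 : A)) = c • 1 := by
    intro c
    rw [hcs, map_one]
  have hQs : ∀ (i : Fin N) (a : Fin (l + 1)), Q a (i + 1) = ρ (Qf q p th i a) := by
    intro i a
    refine Fin.cases ?_ (fun m => ?_) a
    · rw [Fin.val_zero, hQ0 _ (b1 i) (b2 i), qsum, ← cs1, ← map_add, ← hth]
      rfl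
    · rw [Fin.val_succ, hq]
      rfl
  have hPs : ∀ (i : Fin N) (a : Fin (l + 1)), P a (i + 1) = ρ (Pf p i a) := by
    intro i a
    refine Fin.cases ?_ (fun m => ?_) a
    · rw [Fin.val_zero, hP0 _ (b1 i) (b2 i)]
      show _ = ρ (-1)
      rw [map_neg, map_one]
    · rw [Fin.val_succ, hp]
      rfl
  have hPz : ∀ (a : Fin (l + 1)), P a 0 = ρ (Pz (Xf q p th ka) a) := by
    intro a
    refine Fin.cases ?_ (fun m => ?_) a
    · rw [Fin.val_zero, hP00]
      show _ = ρ (-1)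
      rw [map_neg, map_one]
    · show _ = ρ (ka m.succ • 1 + ∑ i, q m i * p m i)
      rw [Fin.val_succ, hPm0 _ (by omega) (by omega), map_add, hka, cs1, icc_aux, map_sum]
      congr 1
      refine Finset.sum_congr rfl fun i _ => ?_
      rw [map_mul, ← hq, ← hp]
  have hQz : ∀ (a : Fin (l + 1)), Q a 0 = ρ (Qz (Xf q p th ka) a) := by
    intro a
    refine Fin.cases ?_ (fun m => ?_) a
    · show _ = ρ (ka 0 • 1 + ∑ i, (th i • 1 + ∑ m, q m i * p m i) * (-1))
      rw [Fin.val_zero, hQ00, map_add, hka, cs1, icc_aux, icc_aux, map_sum, sub_smul, Finset.sum_smul,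
        sub_sub, ← Finset.sum_add_distrib, sub_eq_add_neg, ← Finset.sum_neg_distrib]
      congr 1
      refine Finset.sum_congr rfl fun i _ => ?_
      rw [qsum, mul_neg_one, map_neg, map_add, hth, cs1]
    · rw [Fin.val_succ, hQm0 _ (by omega) (by omega)]
      show _ = ρ (-1)
      rw [map_neg, map_one]
  unfold Zf
  rw [map_add, map_add, map_add, map_add]
  refine congrArg₂ (· + ·) (congrArg₂ (· + ·) (congrArg₂ (· + ·) (congrArg₂ (· + ·) ?_ ?_) ?_) ?_) ?_
  · rw [Finset.sum_range, map_sum]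
    refine Finset.sum_congr rfl fun n _ => ?_
    rw [hee, hcs, map_mul, hQs, hPs]
  · rw [Finset.sum_range_succ', add_comm, map_add]
    refine congrArg₂ (· + ·) ?_ ?_
    · rw [tri_aux, map_sum]
      refine Finset.sum_congr rfl fun n _ => ?_
      rw [map_sum]
      refine Finset.sum_congr rfl fun m _ => ?_
      split_ifs
      · rw [hQs, hPz, hQz, hPs, map_mul, map_mul, map_mul]
      · rw [map_zero]
    · rw [Finset.sum_range, map_sum]
      refine Finset.sum_congr rfl fun j _ => ?_
      rw [tri_aux, map_sum]
      refine Finset.sum_congr rfl fun n _ => ?_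
      rw [map_sum]
      refine Finset.sum_congr rfl fun m _ => ?_
      split_ifs
      · rw [hQs, hPs, hQs, hPs, map_mul, map_mul, map_mul]
      · rw [map_zero]
  · rw [← hs, map_sum, Finset.sum_range, hz']
    congr 1
    refine Finset.sum_congr rfl fun m _ => ?_
    rw [map_sum, Finset.sum_range]
    refine Finset.sum_congr rfl fun n _ => ?_
    rw [hQs, hPz, hQz, hPs, map_mul, map_mul, map_mul]
  · rw [icc_erase_aux, map_sum]
    refine Finset.sum_congr rfl fun j _ => ?_
    rw [← hs, map_sum, Finset.sum_range, hz', hz']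
    congr 1
    refine Finset.sum_congr rfl fun m _ => ?_
    rw [map_sum, Finset.sum_range]
    refine Finset.sum_congr rfl fun n _ => ?_
    rw [hQs, hPs, hQs, hPs, map_mul, map_mul, map_mul]
  · rw [← hs, map_one, mul_one, icc_erase_aux, hk]
    simp only [hth, hz']

/-- multiplication by a variable -/
def qop (K : Type*) [Field K] (l N : ℕ) (m : Fin l) (i : Fin N) :
    Module.End K (MvPolynomial (Fin l × Fin N) K) := LinearMap.mulLeft K (MvPolynomial.X (m, i))

/-- derivative in a variable -/
def pop (K : Type*) [Field K] (l N : ℕ) (m : Fin l) (i : Fin N) :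
    Module.End K (MvPolynomial (Fin l × Fin N) K) := (MvPolynomial.pderiv (m, i)).toLinearMap

theorem qop_qop (K : Type*) [Field K] (l N : ℕ) (m : Fin l) (i : Fin N) (n : Fin l) (j : Fin N) :
    qop K l N m i * qop K l N n j = qop K l N n j * qop K l N m i := by
  refine LinearMap.ext fun f => ?_
  show MvPolynomial.X _ * (MvPolynomial.X _ * f) = MvPolynomial.X _ * (MvPolynomial.X _ * f)
  ring

theorem pop_pop (K : Type*) [Field K] (l N : ℕ) (m : Fin l) (i : Fin N) (n : Fin l) (j : Fin N) :
    pop K l N m i * pop K l N n j = pop K l N n j * pop K l N m i := by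
  refine LinearMap.ext fun f => ?_
  exact pderiv_comm_aux _ _ _

theorem pderiv_X_aux {σ K : Type*} [Field K] (a b : σ) (f : MvPolynomial σ K) (h : a ≠ b) :
    MvPolynomial.pderiv a (MvPolynomial.X b * f) = MvPolynomial.X b * MvPolynomial.pderiv a f := by
  rw [Derivation.leibniz, MvPolynomial.pderiv_X_of_ne h.symm, smul_zero, add_zero, smul_eq_mul]

theorem pderiv_X_aux2 {σ K : Type*} [Field K] (a : σ) (f : MvPolynomial σ K) :
    MvPolynomial.pderiv a (MvPolynomial.X a * f) = MvPolynomial.X a * MvPolynomial.pderiv a f + f := by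
  rw [Derivation.leibniz, MvPolynomial.pderiv_X_self, smul_eq_mul, smul_eq_mul, mul_one]

theorem pop_qop (K : Type*) [Field K] (l N : ℕ) (m : Fin l) (i : Fin N) (n : Fin l) (j : Fin N) :
    pop K l N m i * qop K l N n j = qop K l N n j * pop K l N m i
      + (if m = n ∧ i = j then 1 else 0) := by
  by_cases h : m = n ∧ i = j
  · rw [if_pos h]
    obtain ⟨rfl, rfl⟩ := h
    exact LinearMap.ext fun f => pderiv_X_aux2 (m, i) f
  · rw [if_neg h, add_zero]
    refine LinearMap.ext fun f => pderiv_X_aux (m, i) (n, j) f ?_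
    intro h'
    exact h ⟨congrArg Prod.fst h', congrArg Prod.snd h'⟩

theorem stmt_aux (l N : ℕ)
    (e κ θ : ℕ → ℂ)
    (K : Type*) [Field K] [Algebra ℂ K]
    (z : ℕ → K)
    (hz_distinct : ∀ i j, 1 ≤ i → i ≤ N → 1 ≤ j → j ≤ N → i ≠ j → z i ≠ z j)
    (hz0 : ∀ i, 1 ≤ i → i ≤ N → z i ≠ 0)
    (hz1 : ∀ i, 1 ≤ i → i ≤ N → z i ≠ 1)
    (D : ℕ → Derivation ℂ K K)
    (hDz : ∀ i j, 1 ≤ i → i ≤ N → 1 ≤ j → j ≤ N →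
      D i (z j) = if i = j then 1 else 0)
    (hDcomm : ∀ i j, 1 ≤ i → i ≤ N → 1 ≤ j → j ≤ N → ∀ k : K,
      D i (D j k) = D j (D i k))
    (Dq : ℕ → Module.End ℂ (MvPolynomial (Fin l × Fin N) K))
    (hDqC : ∀ i, 1 ≤ i → i ≤ N → ∀ k : K,
      Dq i (MvPolynomial.C k) = MvPolynomial.C (D i k))
    (hDqX : ∀ i, 1 ≤ i → i ≤ N → ∀ v, Dq i (MvPolynomial.X v) = 0)
    (hDqmul : ∀ i, 1 ≤ i → i ≤ N → ∀ f g,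
      Dq i (f * g) = Dq i f * g + f * Dq i g)
    (Q P : ℕ → ℕ → Module.End ℂ (MvPolynomial (Fin l × Fin N) K))
    (hQ : ∀ (m : Fin l) (i : Fin N),
      Q (m + 1) (i + 1) = LinearMap.mulLeft ℂ (MvPolynomial.X (m, i)))
    (hP : ∀ (m : Fin l) (i : Fin N),
      P (m + 1) (i + 1) = (MvPolynomial.pderiv (m, i)).toLinearMap.restrictScalars ℂ)
    (hQ0 : ∀ i, 1 ≤ i → i ≤ N →
      Q 0 i = θ i • (1 : Module.End ℂ (MvPolynomial (Fin l × Fin N) K))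
        + ∑ m ∈ Finset.Icc 1 l, Q m i * P m i)
    (hP0 : ∀ i, 1 ≤ i → i ≤ N → P 0 i = -1)
    (hQm0 : ∀ m, 1 ≤ m → m ≤ l → Q m 0 = -1)
    (hPm0 : ∀ m, 1 ≤ m → m ≤ l →
      P m 0 = κ m • (1 : Module.End ℂ (MvPolynomial (Fin l × Fin N) K))
        + ∑ i ∈ Finset.Icc 1 N, Q m i * P m i)
    (hQ00 : Q 0 0 = (κ 0 - ∑ i ∈ Finset.Icc 1 N, θ i) •
        (1 : Module.End ℂ (MvPolynomial (Fin l × Fin N) K))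
      - ∑ i ∈ Finset.Icc 1 N, ∑ m ∈ Finset.Icc 1 l, Q m i * P m i)
    (hP00 : P 0 0 = -1)
    (H : ℕ → Module.End ℂ (MvPolynomial (Fin l × Fin N) K))
    (L : ℕ) (hL : L = l + 1)
    (hH : ∀ i, 1 ≤ i → i ≤ N → LinearMap.mulLeft ℂ (MvPolynomial.C (z i)) * H i =
      (∑ n ∈ Finset.range L, e n • (Q n i * P n i))
      + (∑ j ∈ Finset.range (N + 1), ∑ n ∈ Finset.range L, ∑ m ∈ Finset.range n,
          Q m i * P m j * Q n j * P n i)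
      + LinearMap.mulLeft ℂ (MvPolynomial.C ((z i - 1)⁻¹)) * (∑ m ∈ Finset.range L, ∑ n ∈ Finset.range L,
          Q m i * P m 0 * Q n 0 * P n i)
      + (∑ j ∈ (Finset.Icc 1 N).erase i, LinearMap.mulLeft ℂ (MvPolynomial.C (z j / (z i - z j))) *
          (∑ m ∈ Finset.range L, ∑ n ∈ Finset.range L, Q m i * P n i * Q n j * P m j))
      + LinearMap.mulLeft ℂ (MvPolynomial.C (algebraMap ℂ K (θ i) *
          (algebraMap ℂ K (e 0) + algebraMap ℂ K (κ 0)
            - (∑ j ∈ Finset.Icc 1 N, algebraMap ℂ K (θ j))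
            - ∑ j ∈ (Finset.Icc 1 N).erase i,
                algebraMap ℂ K (θ j) * z j / (z i - z j))))) :
    ∀ κc : ℂ, ∀ i j, 1 ≤ i → i ≤ N → 1 ≤ j → j ≤ N →
      (κc • Dq i - H i) * (κc • Dq j - H j)
        = (κc • Dq j - H j) * (κc • Dq i - H i) := by
  subst hL
  have b1 : ∀ i : Fin N, 1 ≤ (i : ℕ) + 1 := fun i => by omega
  have b2 : ∀ i : Fin N, (i : ℕ) + 1 ≤ N := fun i => by omega
  obtain ⟨th, hth⟩ : ∃ th : Fin N → K, ∀ i, th i = algebraMap ℂ K (θ (i + 1)) := ⟨_, fun _ => rfl⟩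
  obtain ⟨ka, hka⟩ : ∃ th : Fin (l + 1) → K, ∀ i, th i = algebraMap ℂ K (κ i) := ⟨_, fun _ => rfl⟩
  obtain ⟨ee, hee⟩ : ∃ th : Fin (l + 1) → K, ∀ i, th i = algebraMap ℂ K (e i) := ⟨_, fun _ => rfl⟩
  obtain ⟨z', hz'⟩ : ∃ th : Fin N → K, ∀ i, th i = z (i + 1) := ⟨_, fun _ => rfl⟩
  obtain ⟨c0, hc0⟩ : ∃ c0 : K, c0 = algebraMap ℂ K (e 0) + algebraMap ℂ K (κ 0)
            - (∑ j ∈ Finset.Icc 1 N, algebraMap ℂ K (θ j)) := ⟨_, rfl⟩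
  obtain ⟨k, hk⟩ : ∃ k : Fin N → K, ∀ i, k i =
    th i * (c0 - ∑ j ∈ Finset.univ.erase i, th j * z' j / (z' i - z' j)) := ⟨_, fun _ => rfl⟩
  rw [← hc0] at hH
  have hZ := bound_aux (rho (Fin l × Fin N) K) (fun c => LinearMap.mulLeft ℂ (MvPolynomial.C c))
    (fun c x => (rho_smul c x).symm) rho_csmul (qop K l N) (pop K l N) e κ θ z Q P hQ hP hQ0 hP0 hQm0 hPm0
    hQ00 hP00 th z' k ka ee hth hka hee hz' c0 hk
  have main := core_aux (qop K l N) (pop K l N) th ka ee z' k c0 hk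
    (qop_qop K l N) (pop_pop K l N) (pop_qop K l N)
    (by
      intro i j h
      rw [hz', hz']
      exact hz_distinct _ _ (b1 i) (b2 i) (b1 j) (b2 j) (fun h' => h (Fin.ext (by omega))))
    (fun i => hz' i ▸ hz0 _ (b1 i) (b2 i)) (fun i => hz' i ▸ hz1 _ (b1 i) (b2 i))
    (fun i => D (i + 1))
    (by
      intro i j
      rw [hz', hDz _ _ (b1 i) (b2 i) (b1 j) (b2 j)]
      simp [Fin.ext_iff])
    (fun a i => by rw [hth]; exact Derivation.map_algebraMap _ _)
    (fun a i => by rw [hka]; exact Derivation.map_algebraMap _ _)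
    (fun a i => by rw [hee]; exact Derivation.map_algebraMap _ _)
    (by
      intro a
      rw [hc0, ← map_sum, ← map_add, ← map_sub]
      exact Derivation.map_algebraMap _ _)
    (fun i j k => hDcomm _ _ (b1 i) (b2 i) (b1 j) (b2 j) k)
    (fun i => Dq (i + 1))
    (fun i => hDqC _ (b1 i) (b2 i)) (fun i => hDqX _ (b1 i) (b2 i)) (fun i => hDqmul _ (b1 i) (b2 i))
    (by
      intro i m j
      unfold Der
      rw [map_zero, add_zero]
      refine LinearMap.ext fun f => ?_
      show Dq _ (MvPolynomial.X _ * f) = MvPolynomial.X _ * Dq _ f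
      rw [hDqmul _ (b1 i) (b2 i), hDqX _ (b1 i) (b2 i), zero_mul, zero_add])
    (by
      intro i m j
      unfold Der
      rw [map_zero, add_zero]
      refine LinearMap.ext fun f => ?_
      show Dq _ (MvPolynomial.pderiv _ f) = MvPolynomial.pderiv _ (Dq _ f)
      exact pderiv_mul_X_aux _ _ (hDqC _ (b1 i) (b2 i)) (hDqX _ (b1 i) (b2 i))
        (hDqmul _ (b1 i) (b2 i)) _ _)
    (fun i => H (i + 1))
    (by
      intro i
      rw [hz' i]
      exact (hH _ (b1 i) (b2 i)).trans (hZ i))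
  intro κc i j hi hi' hj hj'
  have := main κc ⟨i - 1, by omega⟩ ⟨j - 1, by omega⟩
  simp only [Nat.sub_add_cancel hi, Nat.sub_add_cancel hj] at this
  exact this

theorem stmt5 (L N : ℕ) (hL : 2 ≤ L) (hN : 1 ≤ N)
    (e κ θ : ℕ → ℂ)
    (he_sum : ∑ m ∈ Finset.range L, e m = ((L : ℂ) - 1) / 2)
    (hκ_sum : ∑ m ∈ Finset.range L, κ m = ∑ i ∈ Finset.range (N + 1), θ i)
    (K : Type*) [Field K] [Algebra ℂ K]
    (z : ℕ → K)
    (hz_distinct : ∀ i j, 1 ≤ i → i ≤ N → 1 ≤ j → j ≤ N → i ≠ j → z i ≠ z j)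
    (hz0 : ∀ i, 1 ≤ i → i ≤ N → z i ≠ 0)
    (hz1 : ∀ i, 1 ≤ i → i ≤ N → z i ≠ 1)
    (D : ℕ → Derivation ℂ K K)
    (hDz : ∀ i j, 1 ≤ i → i ≤ N → 1 ≤ j → j ≤ N →
      D i (z j) = if i = j then 1 else 0)
    (hDcomm : ∀ i j, 1 ≤ i → i ≤ N → 1 ≤ j → j ≤ N → ∀ k : K,
      D i (D j k) = D j (D i k))
    (Dq : ℕ → Module.End ℂ (MvPolynomial (Fin (L - 1) × Fin N) K))
    (hDqC : ∀ i, 1 ≤ i → i ≤ N → ∀ k : K,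
      Dq i (MvPolynomial.C k) = MvPolynomial.C (D i k))
    (hDqX : ∀ i, 1 ≤ i → i ≤ N → ∀ v, Dq i (MvPolynomial.X v) = 0)
    (hDqmul : ∀ i, 1 ≤ i → i ≤ N → ∀ f g,
      Dq i (f * g) = Dq i f * g + f * Dq i g)
    (Q P : ℕ → ℕ → Module.End ℂ (MvPolynomial (Fin (L - 1) × Fin N) K))
    (hQ : ∀ m i, ∀ hm : 1 ≤ m ∧ m ≤ L - 1, ∀ hi : 1 ≤ i ∧ i ≤ N,
      Q m i = LinearMap.mulLeft ℂ
        (MvPolynomial.X (⟨m - 1, by omega⟩, ⟨i - 1, by omega⟩)))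
    (hP : ∀ m i, ∀ hm : 1 ≤ m ∧ m ≤ L - 1, ∀ hi : 1 ≤ i ∧ i ≤ N,
      P m i = ((MvPolynomial.pderiv
        (⟨m - 1, by omega⟩, ⟨i - 1, by omega⟩)).toLinearMap.restrictScalars ℂ))
    (hQ0 : ∀ i, 1 ≤ i → i ≤ N →
      Q 0 i = θ i • (1 : Module.End ℂ (MvPolynomial (Fin (L - 1) × Fin N) K))
        + ∑ m ∈ Finset.Icc 1 (L - 1), Q m i * P m i)
    (hP0 : ∀ i, 1 ≤ i → i ≤ N → P 0 i = -1)
    (hQm0 : ∀ m, 1 ≤ m → m ≤ L - 1 → Q m 0 = -1)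
    (hPm0 : ∀ m, 1 ≤ m → m ≤ L - 1 →
      P m 0 = κ m • (1 : Module.End ℂ (MvPolynomial (Fin (L - 1) × Fin N) K))
        + ∑ i ∈ Finset.Icc 1 N, Q m i * P m i)
    (hQ00 : Q 0 0 = (κ 0 - ∑ i ∈ Finset.Icc 1 N, θ i) •
        (1 : Module.End ℂ (MvPolynomial (Fin (L - 1) × Fin N) K))
      - ∑ i ∈ Finset.Icc 1 N, ∑ m ∈ Finset.Icc 1 (L - 1), Q m i * P m i)
    (hP00 : P 0 0 = -1)
    (H : ℕ → Module.End ℂ (MvPolynomial (Fin (L - 1) × Fin N) K))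
    (hH : ∀ i, 1 ≤ i → i ≤ N → scmul L N K (z i) * H i =
      (∑ n ∈ Finset.range L, e n • (Q n i * P n i))
      + (∑ j ∈ Finset.range (N + 1), ∑ n ∈ Finset.range L, ∑ m ∈ Finset.range n,
          Q m i * P m j * Q n j * P n i)
      + scmul L N K ((z i - 1)⁻¹) * (∑ m ∈ Finset.range L, ∑ n ∈ Finset.range L,
          Q m i * P m 0 * Q n 0 * P n i)
      + (∑ j ∈ (Finset.Icc 1 N).erase i, scmul L N K (z j / (z i - z j)) *
          (∑ m ∈ Finset.range L, ∑ n ∈ Finset.range L, Q m i * P n i * Q n j * P m j))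
      + scmul L N K (algebraMap ℂ K (θ i) *
          (algebraMap ℂ K (e 0) + algebraMap ℂ K (κ 0)
            - (∑ j ∈ Finset.Icc 1 N, algebraMap ℂ K (θ j))
            - ∑ j ∈ (Finset.Icc 1 N).erase i,
                algebraMap ℂ K (θ j) * z j / (z i - z j)))) :
    ∀ κc : ℂ, ∀ i j, 1 ≤ i → i ≤ N → 1 ≤ j → j ≤ N →
      (κc • Dq i - H i) * (κc • Dq j - H j)
        = (κc • Dq j - H j) * (κc • Dq i - H i) := by
  exact stmt_aux (L - 1) N e κ θ K z hz_distinct hz0 hz1 D hDz hDcomm Dq hDqC hDqX hDqmul Q P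
    (fun m i => hQ (m + 1) (i + 1) ⟨by omega, by omega⟩ ⟨by omega, by omega⟩)
    (fun m i => hP (m + 1) (i + 1) ⟨by omega, by omega⟩ ⟨by omega, by omega⟩)
    hQ0 hP0 hQm0 hPm0 hQ00 hP00 H L (by omega) hH
end
end
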